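/- arXiv:1502.04411 — 2 statements merged into one kernel-verified Lean document; each statement's English description precedes it below -/
import Mathlib

section
/- If S is a set of distinct monomials of A whose F-span is a Kummer space, then S has at most 4n+1 elements; equivalently, every monomial Kummer subspace of A has F-dimension at most 4n+1. -/
/-- A fixed presentation of a tensor product of `n` cyclic algebras of degree 4
over `F`: generators `x k`, `y k` with `(x k)⁴ = αₖ·1`, `(y k)⁴ = βₖ·1`,
`x k · y k = i · (y k · x k)`, generators with different indices commuting, and the
`x k, y k` generating `A` as an `F`-algebra. -/
structure TensorCyclicPres (F A : Type*) [Field F] [Ring A] [Algebra F A]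
    (i : F) (n : ℕ) where
  x : Fin n → A
  y : Fin n → A
  α : Fin n → F
  β : Fin n → F
  α_ne_zero : ∀ k, α k ≠ 0
  β_ne_zero : ∀ k, β k ≠ 0
  x_pow : ∀ k, x k ^ 4 = algebraMap F A (α k)
  y_pow : ∀ k, y k ^ 4 = algebraMap F A (β k)
  xy_rel : ∀ k, x k * y k = i • (y k * x k)
  xx_comm : ∀ k l, k ≠ l → Commute (x k) (x l)
  yy_comm : ∀ k l, k ≠ l → Commute (y k) (y l)
  xy_comm : ∀ k l, k ≠ l → Commute (x k) (y l)
  generates : Algebra.adjoin F (Set.range x ∪ Set.range y) = ⊤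

/-- A monomial with respect to the presentation: an element of the form
`∏ₖ (x k)^{aₖ} (y k)^{bₖ}` with `0 ≤ aₖ, bₖ ≤ 3`. -/
def TensorCyclicPres.IsMonomial {F A : Type*} [Field F] [Ring A] [Algebra F A]
    {i : F} {n : ℕ} (P : TensorCyclicPres F A i n) (v : A) : Prop :=
  ∃ a b : Fin n → Fin 4,
    v = ((List.finRange n).map (fun k => P.x k ^ (a k : ℕ) * P.y k ^ (b k : ℕ))).prod


namespace KummerAux

/-- Exponent vectors. -/
abbrev Ex (n : ℕ) (R : Type*) := (Fin n ⊕ Fin n) → R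

/-- The standard symplectic form. -/
noncomputable def om (n : ℕ) (R : Type*) [CommRing R] : Ex n R →ₗ[R] Ex n R →ₗ[R] R :=
  LinearMap.mk₂ R (fun p q => ∑ k, (p (Sum.inl k) * q (Sum.inr k) - p (Sum.inr k) * q (Sum.inl k)))
    (by intro a b c; rw [← Finset.sum_add_distrib]; apply Finset.sum_congr rfl; intros
        simp only [Pi.add_apply]; ring)
    (by intro a b c; rw [smul_eq_mul, Finset.mul_sum]; apply Finset.sum_congr rfl; intros
        simp only [Pi.smul_apply, smul_eq_mul]; ring)
    (by intro a b c; rw [← Finset.sum_add_distrib]; apply Finset.sum_congr rfl; intros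
        simp only [Pi.add_apply]; ring)
    (by intro a b c; rw [smul_eq_mul, Finset.mul_sum]; apply Finset.sum_congr rfl; intros
        simp only [Pi.smul_apply, smul_eq_mul]; ring)

lemma om_apply {n : ℕ} {R : Type*} [CommRing R] (p q : Ex n R) :
    om n R p q = ∑ k, (p (Sum.inl k) * q (Sum.inr k) - p (Sum.inr k) * q (Sum.inl k)) := rfl

lemma om_swap {n : ℕ} {R : Type*} [CommRing R] (p q : Ex n R) : om n R p q = - om n R q p := by
  rw [om_apply, om_apply, ← Finset.sum_neg_distrib]
  apply Finset.sum_congr rfl; intros; ring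

lemma om_self {n : ℕ} {R : Type*} [CommRing R] (p : Ex n R) : om n R p p = 0 := by
  rw [om_apply]; apply Finset.sum_eq_zero; intros; ring

/-- Reduction mod 2. -/
def red {n : ℕ} (p : Ex n (ZMod 4)) : Ex n (ZMod 2) :=
  fun k => ZMod.castHom (show 2 ∣ 4 by norm_num) (ZMod 2) (p k)

lemma red_eq_iff {n : ℕ} (p q : Ex n (ZMod 4)) : red p = red q ↔ p + p = q + q := by
  have h : ∀ a b : ZMod 4, ZMod.castHom (show 2 ∣ 4 by norm_num) (ZMod 2) a =
      ZMod.castHom (show 2 ∣ 4 by norm_num) (ZMod 2) b ↔ a + a = b + b := by decide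
  constructor
  · intro e; funext k; exact (h _ _).1 (congrFun e k)
  · intro e; funext k; exact (h _ _).2 (congrFun e k)

lemma red_om {n : ℕ} (p q : Ex n (ZMod 4)) :
    om n (ZMod 2) (red p) (red q) =
      ZMod.castHom (show 2 ∣ 4 by norm_num) (ZMod 2) (om n (ZMod 4) p q) := by
  rw [om_apply, om_apply, map_sum]
  apply Finset.sum_congr rfl; intros
  rw [map_sub, map_mul, map_mul]; rfl

lemma red_sum {n : ℕ} {ι : Type*} (s : Finset ι) (f : ι → Ex n (ZMod 4)) :
    red (∑ j ∈ s, f j) = ∑ j ∈ s, red (f j) := by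
  funext k; simp [red, Finset.sum_apply, map_sum]

lemma om_two {n : ℕ} (p q : Ex n (ZMod 4)) (hp : p + p = 0) (hq : q + q = 0) :
    om n (ZMod 4) p q = 0 := by
  have h : ∀ a b : ZMod 4, a + a = 0 → b + b = 0 → a * b = 0 := by decide
  rw [om_apply]; apply Finset.sum_eq_zero; intro k _
  rw [h _ _ (congrFun hp _) (congrFun hq _), h _ _ (congrFun hp _) (congrFun hq _), sub_zero]

lemma fin_check : ∀ (x y z : ZMod 4), (x = 1 ∨ x = 3) → (y = 1 ∨ y = 3) → (z = 1 ∨ z = 3) →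
    ¬(y = x ∧ z = x) → ¬(y = x + 2 ∧ z = x + 2) → ¬(y = x ∧ z + 2 = x) →
    ¬(y = x + 2 ∧ z + 2 = x + 2) → False := by
  set_option synthInstance.maxSize 1000 in
  set_option synthInstance.maxHeartbeats 400000 in
  decide

/-- Vectors over `F_2` with pairwise symplectic product one: at most `2n+1`,
and in case of equality the sum vanishes. -/
lemma red_bound {n : ℕ} (R : Finset (Ex n (ZMod 2)))
    (h : ∀ p ∈ R, ∀ q ∈ R, p ≠ q → om n (ZMod 2) p q = 1) :
    R.card ≤ 2 * n + 1 ∧ (R.card = 2 * n + 1 → ∑ p ∈ R, p = 0) := by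
  classical
  have key : ∀ T ⊆ R, 2 * n < T.card → ∑ p ∈ T, p = 0 ∧ T = R := by
    intro T hT hc
    have hf : Module.finrank (ZMod 2) (Ex n (ZMod 2)) < T.card := by
      rw [Module.finrank_fintype_fun_eq_card]; simp; omega
    obtain ⟨f, hf0, e, heT, hfe⟩ := Module.exists_nontrivial_relation_of_finrank_lt_card hf
    have pair : ∀ k ∈ R, ∑ p ∈ T, f p * om n (ZMod 2) p k = 0 := by
      intro k _
      have := congrArg (fun z => om n (ZMod 2) z k) hf0
      simpa [map_sum, LinearMap.sum_apply] using this
    have hin : ∀ k ∈ T, ∑ p ∈ T, f p = f k := by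
      intro k hk
      have h1 := pair k (hT hk)
      rw [← Finset.add_sum_erase _ _ hk] at h1 ⊢
      rw [om_self, mul_zero, zero_add] at h1
      rw [add_eq_left, ← h1]
      apply Finset.sum_congr rfl
      intro p hp
      rw [h p (hT (Finset.mem_of_mem_erase hp)) k (hT hk) (Finset.ne_of_mem_erase hp), mul_one]
    have hs : ∑ p ∈ T, f p ≠ 0 := by rw [hin e heT]; exact hfe
    have hs1 : ∑ p ∈ T, f p = 1 := by
      revert hs; generalize ∑ p ∈ T, f p = z; revert z; decide
    constructor
    · rw [← hf0]; apply Finset.sum_congr rfl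
      intro p hp; rw [← hin p hp, hs1, one_smul]
    · apply Finset.Subset.antisymm hT
      intro k hk
      by_contra hkT
      apply hs
      rw [← pair k hk]
      apply Finset.sum_congr rfl
      intro p hp
      rw [h p (hT hp) k hk (by rintro rfl; exact hkT hp), mul_one]
  constructor
  · by_contra hlt
    obtain ⟨T, hT, hTc⟩ := Finset.exists_subset_card_eq (s := R) (n := 2 * n + 1) (by omega)
    have := (key T hT (by omega)).2
    subst this; omega
  · intro hc
    exact (key R (Finset.Subset.refl _) (by omega)).1

theorem comb {n : ℕ} (T : Finset (Ex n (ZMod 4)))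
    (h0 : ∀ p ∈ T, ∀ q ∈ T, om n (ZMod 4) p q = 0 → p = q)
    (h2 : ∀ p ∈ T, ∀ q ∈ T, om n (ZMod 4) p q = 2 → p + p = q + q)
    (h3 : ∀ u ∈ T, ∀ p ∈ T, ∀ q ∈ T, om n (ZMod 4) q p = 2 →
      (om n (ZMod 4) p u = 1 ∨ om n (ZMod 4) p u = 3) →
      om n (ZMod 4) q u = om n (ZMod 4) p u + 2 → u + u + p + q = 0)
    (h4 : ∀ p ∈ T, ∀ q ∈ T, ∀ r ∈ T, (om n (ZMod 4) q p = 1 ∨ om n (ZMod 4) q p = 3) →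
      om n (ZMod 4) p r = om n (ZMod 4) q p → om n (ZMod 4) r q = om n (ZMod 4) q p →
      p + p + q + r = 0) :
    T.card ≤ 4 * n + 1 := by
  classical
  set w := om n (ZMod 4) with hw
  have d4 : ∀ a : ZMod 4, a = 0 ∨ a = 2 ∨ a = 1 ∨ a = 3 := by decide
  have hdbl : ∀ p q : Ex n (ZMod 4), p + p = q + q → (p - q) + (p - q) = 0 := by
    intro p q h
    have : (p - q) + (p - q) = (p + p) - (q + q) := by abel
    rw [this, h, sub_self]
  -- same class: value two
  have hsame : ∀ p ∈ T, ∀ q ∈ T, p ≠ q → red p = red q → w p q = 2 := by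
    intro p hp q hq hne hr
    have h1 : om n (ZMod 2) (red p) (red q) = 0 := by rw [hr, om_self]
    rw [red_om, ← hw] at h1
    have : w p q ≠ 0 := fun h => hne (h0 p hp q hq h)
    revert h1 this; generalize w p q = z; revert z; decide
  have hdiff : ∀ p ∈ T, ∀ q ∈ T, red p ≠ red q → (w p q = 1 ∨ w p q = 3) := by
    intro p hp q hq hne
    rcases d4 (w p q) with h | h | h
    · exact absurd (by rw [h0 p hp q hq h]) hne
    · exact absurd ((red_eq_iff _ _).2 (h2 p hp q hq h)) hne
    · exact h
  -- fibers have at most two elements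
  have hfib : ∀ ρ ∈ T.image red, (T.filter (fun p => red p = ρ)).card ≤ 2 := by
    intro ρ _
    by_contra hlt
    obtain ⟨a, b, c, ha, hb, hc, hab, hac, hbc⟩ := Finset.two_lt_card_iff.1 (not_le.1 hlt)
    rw [Finset.mem_filter] at ha hb hc
    have e1 := hsame a ha.1 b hb.1 hab (by rw [ha.2, hb.2])
    have e2 := hsame a ha.1 c hc.1 hac (by rw [ha.2, hc.2])
    have e3 := hsame b hb.1 c hc.1 hbc (by rw [hb.2, hc.2])
    have e4 := om_two (b - a) (c - a)
      (hdbl _ _ ((red_eq_iff _ _).1 (by rw [ha.2, hb.2])))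
      (hdbl _ _ ((red_eq_iff _ _).1 (by rw [ha.2, hc.2])))
    rw [← hw, map_sub, map_sub, LinearMap.sub_apply, LinearMap.sub_apply, e2, e3, hw, om_self,
      om_swap, ← hw, e1] at e4
    revert e4; decide
  by_contra hbig
  have hRp : ∀ p ∈ T.image red, ∀ q ∈ T.image red, p ≠ q → om n (ZMod 2) p q = 1 := by
    intro p hp q hq hne
    obtain ⟨a, ha, rfl⟩ := Finset.mem_image.1 hp
    obtain ⟨b, hb, rfl⟩ := Finset.mem_image.1 hq
    rw [red_om, ← hw]
    rcases hdiff a ha b hb hne with h | h <;> rw [h] <;> decide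
  obtain ⟨hRc, hRs⟩ := red_bound _ hRp
  have hTc : T.card = ∑ ρ ∈ T.image red, (T.filter (fun p => red p = ρ)).card :=
    Finset.card_eq_sum_card_image red T
  have hle : T.card ≤ 2 * (T.image red).card := by
    rw [hTc, mul_comm, ← smul_eq_mul]
    exact Finset.sum_le_card_nsmul _ _ _ hfib
  have hRcard : (T.image red).card = 2 * n + 1 := by omega
  have hsum := hRs hRcard
  have hfib2 : ∀ ρ ∈ T.image red, (T.filter (fun p => red p = ρ)).card = 2 := by
    have : ∑ ρ ∈ T.image red, (T.filter (fun p => red p = ρ)).card = ∑ ρ ∈ T.image red, 2 := by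
      rw [← hTc, Finset.sum_const, smul_eq_mul]; omega
    exact (Finset.sum_eq_sum_iff_of_le hfib).1 this
  have hch : ∀ ρ : Ex n (ZMod 2), ∃ a b : Ex n (ZMod 4), ρ ∈ T.image red →
      (a ∈ T ∧ b ∈ T ∧ a ≠ b ∧ red a = ρ ∧ red b = ρ) := by
    intro ρ
    by_cases hρ : ρ ∈ T.image red
    · obtain ⟨a, b, hab, he⟩ := Finset.card_eq_two.1 (hfib2 ρ hρ)
      have ha : a ∈ T.filter (fun p => red p = ρ) := by rw [he]; simp
      have hb : b ∈ T.filter (fun p => red p = ρ) := by rw [he]; simp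
      rw [Finset.mem_filter] at ha hb
      exact ⟨a, b, fun _ => ⟨ha.1, hb.1, hab, ha.2, hb.2⟩⟩
    · exact ⟨0, 0, fun h => absurd h hρ⟩
  choose a b hab using hch
  set R := T.image red with hR
  set δ : Ex n (ZMod 2) → Ex n (ZMod 4) := fun ρ => b ρ - a ρ with hδ
  have hδ2 : ∀ ρ ∈ R, δ ρ + δ ρ = 0 := by
    intro ρ hρ
    obtain ⟨_, _, _, h4, h5⟩ := hab ρ hρ
    exact hdbl _ _ ((red_eq_iff _ _).1 (by rw [h4, h5]))
  have hb : ∀ ρ, b ρ = a ρ + δ ρ := by intro ρ; simp [hδ]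
  have hδself : ∀ ρ ∈ R, w (δ ρ) (a ρ) = 2 := by
    intro ρ hρ
    obtain ⟨h1, h2, h3, h4, h5⟩ := hab ρ hρ
    rw [hδ]; simp only
    rw [map_sub, LinearMap.sub_apply, hw, om_self, sub_zero, ← hw]
    exact hsame _ h2 _ h1 h3.symm (by rw [h4, h5])
  have hodd : ∀ ρ ∈ R, ∀ τ ∈ R, ρ ≠ τ → (w (a ρ) (a τ) = 1 ∨ w (a ρ) (a τ) = 3) := by
    intro ρ hρ τ hτ hne
    exact hdiff _ (hab ρ hρ).1 _ (hab τ hτ).1 (by rw [(hab ρ hρ).2.2.2.1, (hab τ hτ).2.2.2.1]; exact hne)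
  have heven : ∀ ρ ∈ R, ∀ x, w (δ ρ) x = 0 ∨ w (δ ρ) x = 2 := by
    intro ρ hρ x
    have : w (δ ρ) x + w (δ ρ) x = 0 := by
      rw [← LinearMap.add_apply, ← map_add, hδ2 ρ hρ, map_zero, LinearMap.zero_apply]
    revert this; generalize w (δ ρ) x = z; revert z; decide
  have hflip : ∀ ρ ∈ R, ∀ τ ∈ R, τ ≠ ρ → w (δ ρ) (a τ) ≠ 0 →
      a τ + a τ + a ρ + b ρ = 0 := by
    intro ρ hρ τ hτ hne hnz
    obtain ⟨h1, h2, h3', h4, h5⟩ := hab ρ hρ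
    apply h3 _ (hab τ hτ).1 _ h1 _ h2 (hsame _ h2 _ h1 h3'.symm (by rw [h4, h5]))
      (hodd ρ hρ τ hτ hne.symm)
    rw [hb, map_add, LinearMap.add_apply, (heven ρ hρ (a τ)).resolve_left hnz]
  have hex : ∀ ρ ∈ R, ∃ τ ∈ R, τ ≠ ρ ∧ w (δ ρ) (a τ) ≠ 0 := by
    intro ρ hρ
    by_contra hcon
    push Not at hcon
    have e1 : w (δ ρ) (∑ τ ∈ R, a τ) = 0 := by
      apply om_two _ _ (hδ2 ρ hρ)
      have : red (∑ τ ∈ R, a τ) = red 0 := by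
        rw [red_sum, Finset.sum_congr rfl (fun τ hτ => (hab τ hτ).2.2.2.1), hsum]
        funext k; simp [red]
      rw [(red_eq_iff _ _).1 this, add_zero]
    rw [map_sum, Finset.sum_eq_single_of_mem ρ hρ (fun τ hτ hne => hcon τ hτ hne),
      hδself ρ hρ] at e1
    revert e1; decide
  choose! k hkR hkne hknz using hex
  have huniq : ∀ ρ ∈ R, ∀ τ ∈ R, τ ≠ ρ → τ ≠ k ρ → w (δ ρ) (a τ) = 0 := by
    intro ρ hρ τ hτ h1 h2
    by_contra hnz
    apply h2
    have e1 := hflip ρ hρ τ hτ h1 hnz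
    have e2 := hflip ρ hρ (k ρ) (hkR ρ hρ) (hkne ρ hρ) (hknz ρ hρ)
    have e3 : a τ + a τ = a (k ρ) + a (k ρ) := by
      rw [← e2] at e1
      exact add_right_cancel (add_right_cancel e1)
    rw [← (hab τ hτ).2.2.2.1, ← (hab _ (hkR ρ hρ)).2.2.2.1]
    exact (red_eq_iff _ _).2 e3
  have hnocyc : ∀ p ∈ T, ∀ q ∈ T, ∀ r ∈ T, red p ≠ red q → red q ≠ red r →
      ¬ (w p r = w q p ∧ w r q = w q p) := by
    rintro p hp q hq r hr hpq hqr ⟨e1, e2⟩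
    have e3 := h4 p hp q hq r hr (hdiff q hq p hp hpq.symm) e1 e2
    apply hqr
    rw [red_eq_iff]
    have d : ∀ x y z : ZMod 4, x + x + y + z = 0 → y + y = z + z := by decide
    funext j
    exact d _ _ _ (congrFun e3 j)
  have hinv : ∀ j ∈ R, k (k j) = j := by
    intro j hj
    by_contra hne
    have hm := hkR j hj
    have hjm := hkne j hj
    have hl := hkR _ hm
    have hlm := hkne _ hm
    set m := k j with hmdef
    set l := k m with hldef
    have f1 : w (δ j) (a m) = 2 := (heven j hj _).resolve_left (hknz j hj)
    have f2 : w (δ j) (a l) = 0 := huniq j hj l hl hne hlm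
    have f3 : w (δ m) (a l) = 2 := (heven m hm _).resolve_left (hknz m hm)
    have f4 : w (δ m) (a j) = 0 := huniq m hm j hj hjm.symm (Ne.symm hne)
    have f5 : w (δ m) (δ j) = 0 := om_two _ _ (hδ2 m hm) (hδ2 j hj)
    obtain ⟨j1, j2, _, j4, j5⟩ := hab j hj
    obtain ⟨m1, m2, _, m4, m5⟩ := hab m hm
    obtain ⟨l1, l2, _, l4, l5⟩ := hab l hl
    have g1 := hodd m hm j hj hjm
    have g2 := hodd j hj l hl (Ne.symm hne)
    have g3 := hodd l hl m hm hlm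
    have sm : ∀ x y, w x y = - w y x := fun x y => om_swap x y
    have c1 := hnocyc _ j1 _ m1 _ l1 (by rw [j4, m4]; exact hjm.symm) (by rw [m4, l4]; exact hlm.symm)
    have c2 := hnocyc _ j2 _ m1 _ l1 (by rw [j5, m4]; exact hjm.symm) (by rw [m4, l4]; exact hlm.symm)
    have c3 := hnocyc _ j1 _ m2 _ l1 (by rw [j4, m5]; exact hjm.symm) (by rw [m5, l4]; exact hlm.symm)
    have c4 := hnocyc _ j2 _ m2 _ l1 (by rw [j5, m5]; exact hjm.symm) (by rw [m5, l4]; exact hlm.symm)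
    have i1 : w (a m) (δ j) = 2 := by rw [sm, f1]; decide
    have i2 : w (a l) (δ m) = 2 := by rw [sm, f3]; decide
    simp only [hb, map_add, LinearMap.add_apply, f2, f4, f5, i1, i2, add_zero] at c1 c2 c3 c4
    exact fin_check _ _ _ g1 g2 g3 c1 c2 c3 c4
  have hpar : ∑ ρ ∈ R, (1 : ZMod 2) = 0 :=
    Finset.sum_involution (fun ρ _ => k ρ) (fun _ _ => by decide)
      (fun ρ hρ _ => hkne ρ hρ) (fun ρ hρ => hkR ρ hρ) (fun ρ hρ => hinv ρ hρ)
  rw [Finset.sum_const, hRcard, nsmul_eq_mul, mul_one] at hpar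
  have h22 : (2 : ZMod 2) = 0 := by decide
  push_cast at hpar
  rw [h22, zero_mul, zero_add] at hpar
  revert hpar; decide

lemma polar1 {A : Type*} [Ring A] (v u : A) :
    12 * (v * v * v * u + v * v * u * v + v * u * v * v + u * v * v * v) =
    8 * ((v + u) ^ 4 - (v - u) ^ 4) - ((v + 2 * u) ^ 4 - (v - 2 * u) ^ 4) := by noncomm_ring

/-- Symmetrization of `v³u`. -/
def D {A : Type*} [Ring A] (v u : A) : A :=
  v * v * v * u + v * v * u * v + v * u * v * v + u * v * v * v

/-- Symmetrization of `v²wu`. -/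
def E {A : Type*} [Ring A] (v w u : A) : A :=
  (v * v * w * u + v * w * v * u + w * v * v * u + v * w * u * v + w * v * u * v + w * u * v * v) +
  (v * v * u * w + v * u * v * w + u * v * v * w + v * u * w * v + u * v * w * v + u * w * v * v)

lemma polar2 {A : Type*} [Ring A] (v w u : A) :
    12 * E v w u =
    8 * (D (v + w) u - D (v - w) u) - (D (v + 2 * w) u - D (v - 2 * w) u) := by
  unfold D E; noncomm_ring

lemma E_mem {F A : Type*} [Field F] [CharZero F] [Ring A] [Algebra F A] (V : Submodule F A)
    (hK : ∀ u ∈ V, u ^ 4 ∈ Set.range (algebraMap F A)) (v w u : A) (hv : v ∈ V) (hw : w ∈ V)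
    (hu : u ∈ V) : E v w u ∈ (⊥ : Subalgebra F A) := by
  have hK' : ∀ u ∈ V, u ^ 4 ∈ (⊥ : Subalgebra F A) := fun u hu => Algebra.mem_bot.2 (hK u hu)
  have two : ∀ u ∈ V, 2 * u ∈ V := fun u hu => by rw [two_mul]; exact V.add_mem hu hu
  have n8 : (8 : A) ∈ (⊥ : Subalgebra F A) := by exact_mod_cast natCast_mem (⊥ : Subalgebra F A) 8
  have div : ∀ z : A, 12 * z ∈ (⊥ : Subalgebra F A) → z ∈ (⊥ : Subalgebra F A) := by
    intro z hz
    have : z = (12 : F)⁻¹ • (12 * z) := by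
      have h12 : (12 : A) * z = (12 : F) • z := by
        rw [Algebra.smul_def, map_ofNat]
      rw [h12, inv_smul_smul₀ (by norm_num)]
    rw [this]; exact Subalgebra.smul_mem _ hz _
  have hD : ∀ v ∈ V, ∀ u ∈ V, D v u ∈ (⊥ : Subalgebra F A) := by
    intro v hv u hu
    apply div
    unfold D; rw [polar1]
    exact sub_mem (mul_mem n8 (sub_mem (hK' _ (V.add_mem hv hu)) (hK' _ (V.sub_mem hv hu))))
      (sub_mem (hK' _ (V.add_mem hv (two u hu))) (hK' _ (V.sub_mem hv (two u hu))))
  apply div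
  rw [polar2]
  exact sub_mem (mul_mem n8 (sub_mem (hD _ (V.add_mem hv hw) _ hu) (hD _ (V.sub_mem hv hw) _ hu)))
      (sub_mem (hD _ (V.add_mem hv (two w hw)) _ hu) (hD _ (V.sub_mem hv (two w hw)) _ hu))

/-- The structure constant. -/
def cf {F : Type*} [Field F] (a b c : F) : F :=
  (1 + a + a ^ 2 + a * b + a ^ 2 * b + a ^ 2 * b ^ 2) +
    c * (1 + b + b ^ 2 + a * b + a * b ^ 2 + a ^ 2 * b ^ 2)

lemma E_eq {F A : Type*} [Field F] [Ring A] [Algebra F A] (v w u : A) (a b c : F)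
    (h1 : w * v = a • (v * w)) (h2 : u * v = b • (v * u)) (h3 : u * w = c • (w * u)) :
    E v w u = cf a b c • (v * v * w * u) := by
  have k1 : ∀ x, w * (v * x) = a • (v * (w * x)) := by
    intro x; rw [← mul_assoc, h1, smul_mul_assoc, mul_assoc]
  have k2 : ∀ x, u * (v * x) = b • (v * (u * x)) := by
    intro x; rw [← mul_assoc, h2, smul_mul_assoc, mul_assoc]
  have k3 : ∀ x, u * (w * x) = c • (w * (u * x)) := by
    intro x; rw [← mul_assoc, h3, smul_mul_assoc, mul_assoc]
  unfold E cf
  simp only [mul_assoc, k1, k2, k3, h1, h2, h3, mul_smul_comm, smul_mul_assoc, smul_smul]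
  module

/-- The character `s ↦ i^s`. -/
def ze {F : Type*} [Field F] (i : F) (s : ZMod 4) : F := i ^ s.val

lemma i_four {F : Type*} [Field F] {i : F} (hi : i ^ 2 = -1) : i ^ 4 = 1 := by
  calc i ^ 4 = (i ^ 2) ^ 2 := by ring
    _ = 1 := by rw [hi]; norm_num

lemma ze_add {F : Type*} [Field F] {i : F} (hi : i ^ 2 = -1) (s t : ZMod 4) :
    ze i (s + t) = ze i s * ze i t := by
  unfold ze
  rw [ZMod.val_add, ← pow_add]
  conv_rhs => rw [← Nat.mod_add_div (s.val + t.val) 4, pow_add, pow_mul, i_four hi, one_pow, mul_one]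

lemma ze_zero {F : Type*} [Field F] (i : F) : ze i 0 = 1 := by simp [ze]

lemma ze_one {F : Type*} [Field F] (i : F) : ze i 1 = i := by
  have : (1 : ZMod 4).val = 1 := by decide
  simp [ze, this]

lemma ze_two {F : Type*} [Field F] {i : F} (hi : i ^ 2 = -1) : ze i 2 = -1 := by
  have : (2 : ZMod 4).val = 2 := by decide
  simp [ze, this, hi]

lemma ze_three {F : Type*} [Field F] {i : F} (hi : i ^ 2 = -1) : ze i 3 = -i := by
  have : (3 : ZMod 4).val = 3 := by decide
  simp only [ze, this]
  rw [pow_succ, hi]; ring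

lemma i_ne {F : Type*} [Field F] [CharZero F] {i : F} (hi : i ^ 2 = -1) (a b : ℤ)
    (h : (a : F) + b * i = 0) : a ^ 2 + b ^ 2 = 0 := by
  have : ((a : F) + b * i) * (a - b * i) = 0 := by rw [h, zero_mul]
  have h2 : ((a ^ 2 + b ^ 2 : ℤ) : F) = 0 := by
    push_cast
    linear_combination this + (b : F) ^ 2 * hi
  exact_mod_cast h2

lemma ze_eq_one {F : Type*} [Field F] [CharZero F] {i : F} (hi : i ^ 2 = -1) (s : ZMod 4)
    (h : ze i s = 1) : s = 0 := by
  have d4 : ∀ a : ZMod 4, a = 0 ∨ a = 1 ∨ a = 2 ∨ a = 3 := by decide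
  rcases d4 s with rfl | rfl | rfl | rfl
  · rfl
  · rw [ze_one] at h
    have := i_ne hi (-1) 1 (by push_cast; rw [h]; ring)
    norm_num at this
  · rw [ze_two hi] at h
    have := i_ne hi (-2) 0 (by push_cast; linear_combination h)
    norm_num at this
  · rw [ze_three hi] at h
    have := i_ne hi (-1) (-1) (by push_cast; linear_combination h)
    norm_num at this

/-- `v` and `w` commute up to `i^s`. -/
def Q {F A : Type*} [Field F] [Ring A] [Algebra F A] (i : F) (s : ZMod 4) (v w : A) : Prop :=
  v * w = ze i s • (w * v)

section Qlemmas
variable {F A : Type*} [Field F] [Ring A] [Algebra F A] {i : F}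

lemma Q_mul_left (hi : i ^ 2 = -1) {s t : ZMod 4} {v v' w : A} (h : Q i s v w) (h' : Q i t v' w) :
    Q i (s + t) (v * v') w := by
  unfold Q at *
  rw [mul_assoc, h', mul_smul_comm, ← mul_assoc, h, smul_mul_assoc, smul_smul, ze_add hi, mul_assoc,
    mul_comm (ze i t)]

lemma Q_symm (hi : i ^ 2 = -1) {s : ZMod 4} {v w : A} (h : Q i s v w) : Q i (-s) w v := by
  unfold Q at *
  rw [h, smul_smul, ← ze_add hi, neg_add_cancel, ze_zero, one_smul]

lemma Q_mul_right (hi : i ^ 2 = -1) {s t : ZMod 4} {v w w' : A} (h : Q i s v w) (h' : Q i t v w') :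
    Q i (s + t) v (w * w') := by
  have := Q_symm hi (Q_mul_left hi (Q_symm hi h) (Q_symm hi h'))
  simpa [add_comm] using this

lemma Q_one_left (v : A) : Q i 0 1 v := by simp [Q, ze_zero]

lemma Q_one_right (v : A) : Q i 0 v 1 := by simp [Q, ze_zero]

lemma Q_pow_left (hi : i ^ 2 = -1) {s : ZMod 4} {v w : A} (h : Q i s v w) (m : ℕ) :
    Q i (m * s) (v ^ m) w := by
  induction m with
  | zero => simpa using Q_one_left w
  | succ m ih =>
    have := Q_mul_left hi ih h
    rw [pow_succ]; convert this using 1; push_cast; ring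

lemma Q_pow_right (hi : i ^ 2 = -1) {s : ZMod 4} {v w : A} (h : Q i s v w) (m : ℕ) :
    Q i (m * s) v (w ^ m) := by
  have := Q_symm hi (Q_pow_left hi (Q_symm hi h) m)
  simpa using this

lemma Q_list_right (hi : i ^ 2 = -1) {ι : Type*} (l : List ι) (s : ι → ZMod 4) (f : ι → A) (v : A)
    (h : ∀ k, Q i (s k) v (f k)) : Q i ((l.map s).sum) v ((l.map f).prod) := by
  induction l with
  | nil => simpa using Q_one_right v
  | cons k l ih => simpa using Q_mul_right hi (h k) ih

lemma Q_comm {v w : A} (h : Commute v w) : Q i 0 v w := by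
  unfold Q; rw [ze_zero, one_smul]; exact h

end Qlemmas

section Mono
variable {F A : Type*} [Field F] [DivisionRing A] [Algebra F A] {i : F} {n : ℕ}

/-- The monomial with given exponents. -/
def mono (P : TensorCyclicPres F A i n) (p : Ex n (ZMod 4)) : A :=
  ((List.finRange n).map
    (fun k => P.x k ^ (p (Sum.inl k)).val * P.y k ^ (p (Sum.inr k)).val)).prod

lemma Qx_mono (hi : i ^ 2 = -1) (P : TensorCyclicPres F A i n) (p : Ex n (ZMod 4)) (k : Fin n) :
    Q i (p (Sum.inr k)) (P.x k) (mono P p) := by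
  have := Q_list_right hi (List.finRange n) (fun l => if l = k then p (Sum.inr k) else 0)
    (fun k => P.x k ^ (p (Sum.inl k)).val * P.y k ^ (p (Sum.inr k)).val) (P.x k) ?_
  · rw [← List.ofFn_eq_map, List.sum_ofFn] at this
    simpa [mono] using this
  · intro l
    by_cases h : l = k
    · subst h
      have h1 : Q i 1 (P.x l) (P.y l) := by unfold Q; rw [ze_one]; exact P.xy_rel l
      have h2 := Q_mul_right hi (Q_pow_right hi (Q_comm (i := i) (Commute.refl (P.x l)))
        (p (Sum.inl l)).val) (Q_pow_right hi h1 (p (Sum.inr l)).val)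
      simpa using h2
    · have h2 := Q_mul_right hi (Q_pow_right hi (Q_comm (i := i) (P.xx_comm k l (Ne.symm h)))
        (p (Sum.inl l)).val) (Q_pow_right hi (Q_comm (i := i) (P.xy_comm k l (Ne.symm h)))
          (p (Sum.inr l)).val)
      simpa [h] using h2

lemma Qy_mono (hi : i ^ 2 = -1) (P : TensorCyclicPres F A i n) (p : Ex n (ZMod 4)) (k : Fin n) :
    Q i (-p (Sum.inl k)) (P.y k) (mono P p) := by
  have := Q_list_right hi (List.finRange n) (fun l => if l = k then -p (Sum.inl k) else 0)
    (fun k => P.x k ^ (p (Sum.inl k)).val * P.y k ^ (p (Sum.inr k)).val) (P.y k) ?_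
  · rw [← List.ofFn_eq_map, List.sum_ofFn] at this
    simpa [mono] using this
  · intro l
    by_cases h : l = k
    · subst h
      have h1 : Q i 1 (P.x l) (P.y l) := by unfold Q; rw [ze_one]; exact P.xy_rel l
      have h2 := Q_mul_right hi (Q_pow_right hi (Q_symm hi h1)
        (p (Sum.inl l)).val) (Q_pow_right hi (Q_comm (i := i) (Commute.refl (P.y l)))
          (p (Sum.inr l)).val)
      simpa using h2
    · have h2 := Q_mul_right hi (Q_pow_right hi (Q_comm (i := i) (P.xy_comm l k h).symm)
        (p (Sum.inl l)).val) (Q_pow_right hi (Q_comm (i := i) (P.yy_comm k l (Ne.symm h)))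
          (p (Sum.inr l)).val)
      simpa [h] using h2

lemma Q_mono (hi : i ^ 2 = -1) (P : TensorCyclicPres F A i n) (p q : Ex n (ZMod 4)) :
    Q i (om n (ZMod 4) p q) (mono P p) (mono P q) := by
  have := Q_list_right hi (List.finRange n)
    (fun k => -(q (Sum.inl k) * p (Sum.inr k) - q (Sum.inr k) * p (Sum.inl k)) * (-1))
    (fun k => P.x k ^ (p (Sum.inl k)).val * P.y k ^ (p (Sum.inr k)).val) (mono P q) ?_
  · rw [← List.ofFn_eq_map, List.sum_ofFn] at this
    rw [om_swap, om_apply]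
    apply Q_symm hi
    simpa [mono] using this
  · intro k
    have h2 := Q_symm hi (Q_mul_left hi (Q_pow_left hi (Qx_mono hi P q k) (p (Sum.inl k)).val)
      (Q_pow_left hi (Qy_mono hi P q k) (p (Sum.inr k)).val))
    convert h2 using 1
    simp; ring

lemma x_ne (P : TensorCyclicPres F A i n) (k : Fin n) : P.x k ≠ 0 := by
  intro h
  have := P.x_pow k
  rw [h, zero_pow (by norm_num)] at this
  exact P.α_ne_zero k ((FaithfulSMul.algebraMap_eq_zero_iff F A).1 this.symm)

lemma y_ne (P : TensorCyclicPres F A i n) (k : Fin n) : P.y k ≠ 0 := by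
  intro h
  have := P.y_pow k
  rw [h, zero_pow (by norm_num)] at this
  exact P.β_ne_zero k ((FaithfulSMul.algebraMap_eq_zero_iff F A).1 this.symm)

lemma mono_ne (P : TensorCyclicPres F A i n) (p : Ex n (ZMod 4)) : mono P p ≠ 0 := by
  unfold mono
  rw [Ne, List.prod_eq_zero_iff]
  intro h
  obtain ⟨k, _, hk⟩ := List.mem_map.1 h
  exact mul_ne_zero (pow_ne_zero _ (x_ne P k)) (pow_ne_zero _ (y_ne P k)) hk

lemma Q_central [CharZero F] (hi : i ^ 2 = -1) {s : ZMod 4} {v z : A} (h : Q i s v z)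
    (hv : v ≠ 0) (hz : z ≠ 0) (hc : z ∈ (⊥ : Subalgebra F A)) : s = 0 := by
  obtain ⟨r, rfl⟩ := Algebra.mem_bot.1 hc
  unfold Q at h
  rw [← Algebra.commutes] at h
  apply ze_eq_one hi
  have hne : algebraMap F A r * v ≠ 0 := mul_ne_zero hz hv
  have : (ze i s - 1) • (algebraMap F A r * v) = 0 := by rw [sub_smul, ← h, one_smul, sub_self]
  exact sub_eq_zero.1 ((smul_eq_zero.1 this).resolve_right hne)

lemma main_cond [CharZero F] (hi : i ^ 2 = -1) (P : TensorCyclicPres F A i n) (V : Submodule F A)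
    (hK : ∀ u ∈ V, u ^ 4 ∈ Set.range (algebraMap F A)) (p q r : Ex n (ZMod 4))
    (hp : mono P p ∈ V) (hq : mono P q ∈ V) (hr : mono P r ∈ V)
    (hne : cf (ze i (om n (ZMod 4) q p)) (ze i (om n (ZMod 4) r p))
      (ze i (om n (ZMod 4) r q)) ≠ 0) :
    p + p + q + r = 0 := by
  have h1 := E_mem V hK _ _ _ hp hq hr
  rw [E_eq _ _ _ _ _ _ (Q_mono hi P q p) (Q_mono hi P r p) (Q_mono hi P r q)] at h1
  have h2 := Subalgebra.smul_mem _ h1 (cf (ze i (om n (ZMod 4) q p)) (ze i (om n (ZMod 4) r p))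
      (ze i (om n (ZMod 4) r q)))⁻¹
  rw [inv_smul_smul₀ hne] at h2
  have hz : mono P p * mono P p * mono P q * mono P r ≠ 0 :=
    mul_ne_zero (mul_ne_zero (mul_ne_zero (mono_ne _ _) (mono_ne _ _)) (mono_ne _ _)) (mono_ne _ _)
  funext k
  rcases k with k | k
  · have := Q_central hi (Q_mul_right hi (Q_mul_right hi (Q_mul_right hi (Qy_mono hi P p k)
      (Qy_mono hi P p k)) (Qy_mono hi P q k)) (Qy_mono hi P r k)) (y_ne P k) hz h2
    simp only [Pi.add_apply, Pi.zero_apply]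
    linear_combination -this
  · exact Q_central hi (Q_mul_right hi (Q_mul_right hi (Q_mul_right hi (Qx_mono hi P p k)
      (Qx_mono hi P p k)) (Qx_mono hi P q k)) (Qx_mono hi P r k)) (x_ne P k) hz h2

end Mono

lemma cf_ne {F : Type*} [Field F] [CharZero F] {i : F} (hi : i ^ 2 = -1) (a b c : F) (m k : ℤ)
    (h : cf a b c = m + k * i) (hmk : m ^ 2 + k ^ 2 ≠ 0) : cf a b c ≠ 0 := by
  intro h0
  exact hmk (i_ne hi m k (by rw [← h, h0]))

end KummerAux

open KummerAux in
theorem statement16 {F A : Type*} [Field F] [CharZero F] [DivisionRing A] [Algebra F A]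
    (i : F) (hi : i ^ 2 = -1) (n : ℕ) (hn : 1 ≤ n)
    (P : TensorCyclicPres F A i n) (hdim : Module.finrank F A = 16 ^ n)
    (S : Finset A) (hmon : ∀ v ∈ S, P.IsMonomial v)
    (hK : ∀ u ∈ Submodule.span F (S : Set A), u ^ 4 ∈ Set.range (algebraMap F A)) :
    S.card ≤ 4 * n + 1 := by
  classical
  have hex : ∀ v ∈ S, ∃ p : Ex n (ZMod 4), v = mono P p := by
    intro v hv
    obtain ⟨a, b, h⟩ := hmon v hv
    exact ⟨Sum.elim (fun k => (a k : ZMod 4)) (fun k => (b k : ZMod 4)), h⟩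
  choose! e he using hex
  have hinj : Set.InjOn e S := by
    intro v hv w hw h
    rw [he v hv, he w hw, h]
  rw [← Finset.card_image_of_injOn hinj]
  have hV : ∀ p ∈ S.image e, mono P p ∈ Submodule.span F (S : Set A) := by
    intro p hp
    obtain ⟨v, hv, rfl⟩ := Finset.mem_image.1 hp
    rw [← he v hv]
    exact Submodule.subset_span hv
  have i3 : i ^ 3 = -i := by rw [pow_succ, hi]; ring
  have i4 := i_four hi
  have key : ∀ p ∈ S.image e, ∀ q ∈ S.image e, ∀ r ∈ S.image e, _ := fun p hp q hq r hr =>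
    main_cond hi P _ hK p q r (hV p hp) (hV q hq) (hV r hr)
  have sw : ∀ p q, om n (ZMod 4) p q = - om n (ZMod 4) q p := fun p q => om_swap p q
  have neg1 : -(1 : ZMod 4) = 3 := by decide
  have neg3 : -(3 : ZMod 4) = 1 := by decide
  have a1 : (1 : ZMod 4) + 2 = 3 := by decide
  have a3 : (3 : ZMod 4) + 2 = 1 := by decide
  have neg2 : -(2 : ZMod 4) = 2 := by decide
  apply comb
  · intro p hp q hq h
    have hh := key q hq q hq p hp (by
      rw [om_self, h, ze_zero]
      apply cf_ne hi _ _ _ 12 0 _ (by norm_num)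
      unfold cf; push_cast; ring)
    have d : ∀ x y : ZMod 4, x + x + x + y = 0 → y = x := by decide
    funext j
    exact d _ _ (congrFun hh j)
  · intro p hp q hq h
    have hh := key p hp q hq q hq (by
      rw [om_self, sw q p, h, neg2, ze_zero, ze_two hi]
      apply cf_ne hi _ _ _ 4 0 _ (by norm_num)
      unfold cf; push_cast; ring)
    have d : ∀ x y : ZMod 4, x + x + y + y = 0 → x + x = y + y := by decide
    funext j
    exact d _ _ (congrFun hh j)
  · intro u hu p hp q hq h1 h2 h3
    apply key u hu p hp q hq
    rw [h3, h1, ze_two hi]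
    rcases h2 with h | h <;> rw [h]
    · rw [a1, ze_one, ze_three hi]
      apply cf_ne hi _ _ _ 0 4 _ (by norm_num)
      unfold cf; push_cast; ring_nf; simp only [i3, i4, hi]; ring
    · rw [a3, ze_one, ze_three hi]
      apply cf_ne hi _ _ _ 0 (-4) _ (by norm_num)
      unfold cf; push_cast; ring_nf; simp only [i3, i4, hi]; ring
  · intro p hp q hq r hr h1 h2 h3
    apply key p hp q hq r hr
    rw [sw r p, h2, h3]
    rcases h1 with h | h <;> rw [h]
    · rw [neg1, ze_one, ze_three hi]
      apply cf_ne hi _ _ _ 4 4 _ (by norm_num)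
      unfold cf; push_cast; ring_nf
      have i5 : i ^ 5 = i := by rw [pow_succ, i4]; ring
      simp only [i3, i4, i5, hi]; ring
    · rw [neg3, ze_one, ze_three hi]
      apply cf_ne hi _ _ _ 4 (-4) _ (by norm_num)
      unfold cf; push_cast; ring_nf
      have i5 : i ^ 5 = i := by rw [pow_succ, i4]; ring
      simp only [i3, i4, i5, hi]; ring
end

section
/- Every Kummer subspace V of A satisfies dim_F V ≤ 4n+1, and there exists a Kummer subspace of A of F-dimension exactly 4n+1; that is, the maximal dimension of a Kummer space in the generic tensor product of n cyclic algebras of degree 4 is 4n+1. -/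
namespace Kum

/-- The alternating form. -/
def om {n : ℕ} {R : Type*} [CommRing R] (g h : Fin n × Bool → R) : R :=
  ∑ k, (g (k, true) * h (k, false) - g (k, false) * h (k, true))

section
variable {n : ℕ} {R : Type*} [CommRing R]

lemma om_self (g : Fin n × Bool → R) : om g g = 0 := by
  simp [om, mul_comm]

lemma om_swap (g h : Fin n × Bool → R) : om h g = - om g h := by
  simp only [om, ← Finset.sum_neg_distrib]
  exact Finset.sum_congr rfl fun k _ => by ring

lemma om_add_right (g h h' : Fin n × Bool → R) : om g (h + h') = om g h + om g h' := by
  simp only [om, ← Finset.sum_add_distrib]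
  exact Finset.sum_congr rfl fun k _ => by simp only [Pi.add_apply]; ring

lemma om_smul_right (c : R) (g h : Fin n × Bool → R) : om g (c • h) = c * om g h := by
  simp only [om, Finset.mul_sum]
  exact Finset.sum_congr rfl fun k _ => by simp only [Pi.smul_apply, smul_eq_mul]; ring

lemma om_add_left (g g' h : Fin n × Bool → R) : om (g + g') h = om g h + om g' h := by
  rw [om_swap, om_add_right, om_swap g h, om_swap g' h]; ring

lemma om_smul_left (c : R) (g h : Fin n × Bool → R) : om (c • g) h = c * om g h := by
  rw [om_swap, om_smul_right, om_swap g h]; ring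

lemma om_zero_right (g : Fin n × Bool → R) : om g 0 = 0 := by
  simp [om]

lemma om_sum_right {ι : Type*} (s : Finset ι) (g : Fin n × Bool → R)
    (h : ι → Fin n × Bool → R) : om g (∑ i ∈ s, h i) = ∑ i ∈ s, om g (h i) := by
  classical
  induction s using Finset.induction_on with
  | empty => simp [om_zero_right]
  | insert a s ha ih => rw [Finset.sum_insert ha, Finset.sum_insert ha, om_add_right, ih]

lemma om_map {R' : Type*} [CommRing R'] (φ : R →+* R') (g h : Fin n × Bool → R) :
    om (φ ∘ g) (φ ∘ h) = φ (om g h) := by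
  simp [om, map_sum]
end

/-- Binary vectors with pairwise form 1, more than `2n` of them: their sum vanishes. -/
lemma sum_eq_zero_of_card {n : ℕ} (T : Finset (Fin n × Bool → ZMod 2))
    (hT : ∀ g ∈ T, ∀ h ∈ T, g ≠ h → om g h = 1) (hc : 2 * n < T.card) :
    ∑ e ∈ T, e = 0 := by
  classical
  have hr : Module.finrank (ZMod 2) (Fin n × Bool → ZMod 2) < T.card := by
    rw [Module.finrank_fintype_fun_eq_card]; simp; omega
  obtain ⟨f, hf, x, hx, hfx⟩ := Module.exists_nontrivial_relation_of_finrank_lt_card hr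
  have key : ∀ g ∈ T, f g = ∑ e ∈ T, f e := by
    intro g hg
    have h1 : om g (∑ e ∈ T, f e • e) = 0 := by rw [hf, om_zero_right]
    rw [om_sum_right, ← Finset.add_sum_erase _ _ hg, om_smul_right, om_self, mul_zero,
      zero_add] at h1
    rw [← Finset.add_sum_erase _ _ hg]
    have : ∑ e ∈ T.erase g, om g (f e • e) = ∑ e ∈ T.erase g, f e := by
      refine Finset.sum_congr rfl fun e he => ?_
      rw [om_smul_right, hT g hg e (Finset.mem_of_mem_erase he) (Finset.ne_of_mem_erase he).symm,
        mul_one]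
    rw [← this, h1, add_zero]
  have h2 : ∀ a : ZMod 2, a ≠ 0 → a = 1 := by decide
  have hall : ∀ g ∈ T, f g = 1 := by
    intro g hg
    rw [key g hg, ← key x hx]; exact h2 _ hfx
  rw [← hf]
  exact Finset.sum_congr rfl fun e he => by rw [hall e he, one_smul]

lemma card_le_bin {n : ℕ} (T : Finset (Fin n × Bool → ZMod 2))
    (hT : ∀ g ∈ T, ∀ h ∈ T, g ≠ h → om g h = 1) : T.card ≤ 2 * n + 1 := by
  classical
  by_contra hc
  push Not at hc
  have h0 := sum_eq_zero_of_card T hT (by omega)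
  obtain ⟨a, ha, b, hb, hab⟩ := Finset.one_lt_card.1 (show 1 < T.card by omega)
  have h1 := sum_eq_zero_of_card (T.erase a)
    (fun g hg h hh => hT g (Finset.mem_of_mem_erase hg) h (Finset.mem_of_mem_erase hh))
    (by rw [Finset.card_erase_of_mem ha]; omega)
  rw [← Finset.add_sum_erase _ _ ha, h1, add_zero] at h0
  have := hT b hb a ha hab.symm
  rw [h0, om_zero_right] at this
  exact absurd this (by decide)

/-- reduction modulo 2 -/
def red {n : ℕ} (g : Fin n × Bool → ZMod 4) : Fin n × Bool → ZMod 2 :=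
  (ZMod.castHom (show 2 ∣ 4 by norm_num) (ZMod 2)) ∘ g

lemma red_om {n : ℕ} (g h : Fin n × Bool → ZMod 4) :
    om (red g) (red h) = ZMod.castHom (show 2 ∣ 4 by norm_num) (ZMod 2) (om g h) :=
  om_map _ g h

lemma z4_red_eq : ∀ a b : ZMod 4, ZMod.castHom (show 2 ∣ 4 by norm_num) (ZMod 2) a =
    ZMod.castHom (show 2 ∣ 4 by norm_num) (ZMod 2) b → ∃ t, b = a + 2 * t := by decide

lemma z4_sum : ∀ a b c : ZMod 4, 2 * a + b + c = 0 →
  ZMod.castHom (show 2 ∣ 4 by norm_num) (ZMod 2) b =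
    ZMod.castHom (show 2 ∣ 4 by norm_num) (ZMod 2) c := by decide

lemma z4_sum2 : ∀ a b c d : ZMod 4, 2 * a + b + c = 0 → 2 * d + b + c = 0 →
  ZMod.castHom (show 2 ∣ 4 by norm_num) (ZMod 2) a =
    ZMod.castHom (show 2 ∣ 4 by norm_num) (ZMod 2) d := by decide

lemma z4_two : ∀ a b : ZMod 4, 2 * a + 2 * b = 0 →
  ZMod.castHom (show 2 ∣ 4 by norm_num) (ZMod 2) a =
    ZMod.castHom (show 2 ∣ 4 by norm_num) (ZMod 2) b := by decide

lemma red_eq {n : ℕ} {g h : Fin n × Bool → ZMod 4} (e : red g = red h) :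
    ∃ t, h = g + (2 : ZMod 4) • t := by
  choose t ht using fun i => z4_red_eq (g i) (h i) (congrFun e i)
  exact ⟨t, funext ht⟩

lemma fin_case (a b c d e : ZMod 4) (f1 : a ≠ b) (f2 : c ≠ d) (v1 : a = 1 ∨ a = 3)
    (v2 : b = 1 ∨ b = 3) (v3 : c = 1 ∨ c = 3) (v4 : d = 1 ∨ d = 3) (v5 : e = 1 ∨ e = 3)
    (w1 : ¬ (a = 1 ∧ c = 1 ∧ e = 3) ∧ ¬ (a = 3 ∧ c = 3 ∧ e = 1))
    (w2 : ¬ (a = 1 ∧ d = 1 ∧ e = 3) ∧ ¬ (a = 3 ∧ d = 3 ∧ e = 1))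
    (w3 : ¬ (b = 1 ∧ c = 1 ∧ e = 3) ∧ ¬ (b = 3 ∧ c = 3 ∧ e = 1))
    (w4 : ¬ (b = 1 ∧ d = 1 ∧ e = 3) ∧ ¬ (b = 3 ∧ d = 3 ∧ e = 1)) : False := by
  rcases v1 with rfl | rfl <;> rcases v2 with rfl | rfl <;> rcases v3 with rfl | rfl <;>
    rcases v4 with rfl | rfl <;> rcases v5 with rfl | rfl <;>
    first
    | exact f1 rfl
    | exact f2 rfl
    | exact w1.1 ⟨rfl, rfl, rfl⟩
    | exact w1.2 ⟨rfl, rfl, rfl⟩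
    | exact w2.1 ⟨rfl, rfl, rfl⟩
    | exact w2.2 ⟨rfl, rfl, rfl⟩
    | exact w3.1 ⟨rfl, rfl, rfl⟩
    | exact w3.2 ⟨rfl, rfl, rfl⟩
    | exact w4.1 ⟨rfl, rfl, rfl⟩
    | exact w4.2 ⟨rfl, rfl, rfl⟩

/-- The combinatorial conditions satisfied by the exponents of a monomial Kummer space. -/
structure KS {n : ℕ} (S : Finset (Fin n × Bool → ZMod 4)) : Prop where
  c1 : ∀ g ∈ S, ∀ h ∈ S, g ≠ h → om g h ≠ 0
  c2 : ∀ g ∈ S, ∀ h ∈ S, om g h = 2 → ∀ i, 2 * g i + 2 * h i = 0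
  c3 : ∀ g ∈ S, ∀ h ∈ S, ∀ k ∈ S, om g h = 1 → om h k = 1 → om k g = 1 →
    ∀ i, 2 * g i + h i + k i = 0
  c4 : ∀ g ∈ S, ∀ h ∈ S, ∀ k ∈ S, om h k = 2 → om g h = 1 → om g k = 3 →
    ∀ i, 2 * g i + h i + k i = 0

theorem KS.card_le {n : ℕ} {S : Finset (Fin n × Bool → ZMod 4)} (H : KS S) :
    S.card ≤ 4 * n + 1 := by
  classical
  -- distinct elements of the same class
  have same : ∀ g ∈ S, ∀ h ∈ S, g ≠ h → red g = red h → om g h = 2 := by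
    intro g hg h hh hne e
    obtain ⟨t, rfl⟩ := red_eq e
    have h1 := H.c1 g hg _ hh hne
    rw [om_add_right, om_self, zero_add, om_smul_right] at h1 ⊢
    revert h1; generalize om g t = a; revert a; decide
  have diff : ∀ g ∈ S, ∀ h ∈ S, red g ≠ red h → om g h = 1 ∨ om g h = 3 := by
    intro g hg h hh hne
    have h1 := H.c1 g hg h hh (fun e => hne (by rw [e]))
    have h2 : om g h ≠ 2 := fun h2 => hne (funext fun i => z4_two _ _ (H.c2 g hg h hh h2 i))
    revert h1 h2; generalize om g h = a; revert a; decide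
  have diff' : ∀ g ∈ S, ∀ h ∈ S, red g ≠ red h → om (red g) (red h) = 1 := by
    intro g hg h hh hne
    rw [red_om]
    rcases diff g hg h hh hne with h | h <;> rw [h] <;> decide
  have nocyc : ∀ g ∈ S, ∀ h ∈ S, ∀ k ∈ S, om g h = 1 → om h k = 1 → om k g = 1 → False := by
    intro g hg h hh k hk h1 h2 h3
    have h4 : red h = red k := funext fun i => z4_sum _ _ _ (H.c3 g hg h hh k hk h1 h2 h3 i)
    have h5 := red_om h k
    rw [h4, om_self, h2] at h5
    exact absurd h5 (by decide)
  have split : ∀ p ∈ S, ∀ g ∈ S, ∀ g' ∈ S, red g = red g' → red p ≠ red g → om p g ≠ om p g' →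
      ∀ i, 2 * p i + g i + g' i = 0 := by
    intro p hp g hg g' hg' e hne ho i
    have hgg : g ≠ g' := fun h => ho (by rw [h])
    have h2 := same g hg g' hg' hgg e
    have h2' := same g' hg' g hg hgg.symm e.symm
    rcases diff p hp g hg hne with ha | ha <;> rcases diff p hp g' hg' (e ▸ hne) with hb | hb
    · exact absurd (ha.trans hb.symm) ho
    · exact H.c4 p hp g hg g' hg' h2 ha hb i
    · have := H.c4 p hp g' hg' g hg h2' hb ha i
      rw [← this]; ring
    · exact absurd (ha.trans hb.symm) ho
  set T := S.image red with hTdef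
  have hT : ∀ a ∈ T, ∀ b ∈ T, a ≠ b → om a b = 1 := by
    intro a ha b hb hne
    obtain ⟨g, hg, rfl⟩ := Finset.mem_image.1 ha
    obtain ⟨h, hh, rfl⟩ := Finset.mem_image.1 hb
    exact diff' g hg h hh hne
  have hTc := card_le_bin T hT
  have fib : ∀ a ∈ T, (S.filter (fun g => red g = a)).card ≤ 2 := by
    intro a _
    by_contra hc
    push Not at hc
    obtain ⟨g, h, k, hg, hh, hk, hgh, hgk, hhk⟩ := Finset.two_lt_card_iff.1 hc
    simp only [Finset.mem_filter] at hg hh hk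
    have h1 := same g hg.1 h hh.1 hgh (hg.2.trans hh.2.symm)
    have h2 := same g hg.1 k hk.1 hgk (hg.2.trans hk.2.symm)
    have h3 := same h hh.1 k hk.1 hhk (hh.2.trans hk.2.symm)
    obtain ⟨t, rfl⟩ := red_eq (hg.2.trans hh.2.symm)
    obtain ⟨s, rfl⟩ := red_eq (hg.2.trans hk.2.symm)
    rw [om_add_right, om_self, om_smul_right] at h1 h2
    rw [om_add_left, om_add_right, om_add_right, om_self, om_smul_left, om_smul_left,
      om_smul_right, om_smul_right, om_swap g t] at h3
    revert h1 h2 h3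
    generalize om g t = a
    generalize om g s = b
    generalize om t s = c
    revert a b c
    decide
  by_contra hc
  push Not at hc
  have hsum := Finset.card_eq_sum_card_image red S
  have hle : S.card ≤ T.card * 2 := by
    rw [hsum, ← smul_eq_mul]
    exact Finset.sum_le_card_nsmul _ _ _ fib
  have hTcard : T.card = 2 * n + 1 := by omega
  have fib2 : ∀ a ∈ T, 1 < (S.filter (fun g => red g = a)).card := by
    intro a ha
    by_contra hlt
    have h1 : ∑ b ∈ T.erase a, (S.filter (fun g => red g = b)).card ≤ (T.erase a).card * 2 := by
      rw [← smul_eq_mul]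
      exact Finset.sum_le_card_nsmul _ _ _ fun b hb => fib b (Finset.mem_of_mem_erase hb)
    rw [← Finset.add_sum_erase _ _ ha] at hsum
    rw [Finset.card_erase_of_mem ha] at h1
    omega
  have hpair : ∀ a : T, ∃ g ∈ S, ∃ g' ∈ S, red g = a ∧ red g' = a ∧ g ≠ g' := by
    rintro ⟨a, ha⟩
    obtain ⟨g, hg, g', hg', hne⟩ := Finset.one_lt_card.1 (fib2 a ha)
    rw [Finset.mem_filter] at hg hg'
    exact ⟨g, hg.1, g', hg'.1, hg.2, hg'.2, hne⟩
  choose G hG G' hG' rG rG' hGne using hpair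
  have hT0 := sum_eq_zero_of_card T hT (by omega)
  have hk : ∀ a : T, ∃ b : T, b ≠ a ∧ ∀ p ∈ S, red p = b → om p (G a) ≠ om p (G' a) := by
    intro a
    obtain ⟨t, ht⟩ := red_eq ((rG a).trans (rG' a).symm)
    have h1 : om (red t) (a : Fin n × Bool → ZMod 2) = 1 := by
      have := same _ (hG a) _ (hG' a) (hGne a) ((rG a).trans (rG' a).symm)
      rw [ht, om_add_right, om_self, om_smul_right] at this
      rw [← rG a, red_om, om_swap]
      revert this; generalize om (G a) t = z; revert z; decide
    have h2 : om (red t) (∑ e ∈ T, e) = 0 := by rw [hT0, om_zero_right]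
    rw [om_sum_right, ← Finset.add_sum_erase _ _ a.2, h1] at h2
    have h3 : ∑ e ∈ T.erase a, om (red t) e ≠ 0 := by
      intro h; rw [h] at h2; exact absurd h2 (by decide)
    obtain ⟨b, hb, hb1⟩ := Finset.exists_ne_zero_of_sum_ne_zero h3
    refine ⟨⟨b, Finset.mem_of_mem_erase hb⟩, fun h => Finset.ne_of_mem_erase hb
      (congrArg Subtype.val h), fun p hp hpb => ?_⟩
    simp only at hpb
    rw [← hpb, red_om, om_swap] at hb1
    rw [ht, om_add_right, om_smul_right]
    revert hb1
    generalize om p t = u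
    generalize om p (G a) = v
    revert u v
    decide
  choose k hka hk using hk
  have huniq : ∀ a : T, ∀ p ∈ S, red p ≠ a → red p ≠ k a → om p (G a) = om p (G' a) := by
    intro a p hp hpa hpk
    by_contra hne
    apply hpk
    have e1 := split p hp _ (hG a) _ (hG' a) ((rG a).trans (rG' a).symm) (by rwa [rG a]) hne
    have e2 := split (G (k a)) (hG _) _ (hG a) _ (hG' a) ((rG a).trans (rG' a).symm)
      (by rw [rG a, rG]; exact fun h => hka a (Subtype.ext h)) (hk a _ (hG _) (rG _))
    rw [← rG (k a)]
    exact funext fun i => z4_sum2 _ _ _ _ (e1 i) (e2 i)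
  have hinv : ∃ l : T, k (k l) ≠ l := by
    by_contra hcon
    push Not at hcon
    have h1 : ∑ _a : T, (1 : ZMod 2) = 0 :=
      Finset.sum_involution (fun a _ => k a) (fun _ _ => by decide) (fun a _ _ => hka a)
        (fun _ _ => Finset.mem_univ _) (fun a _ => hcon a)
    rw [Finset.sum_const, Finset.card_univ, Fintype.card_coe, hTcard, nsmul_one] at h1
    have h2 : ((2 : ℕ) : ZMod 2) = 0 := by decide
    push_cast at h1 h2
    rw [h2] at h1
    simp at h1
  obtain ⟨l, hl⟩ := hinv
  have vne : ∀ a b : T, a ≠ b → (a : Fin n × Bool → ZMod 2) ≠ b :=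
    fun a b h h' => h (Subtype.ext h')
  have hjl := vne _ _ (hka l)
  have hmj := vne _ _ (hka (k l))
  have hml := vne _ _ hl
  have f1 := hk (k l) _ (hG (k (k l))) (rG _)
  have f2 := hk l _ (hG (k l)) (rG _)
  have f4 := huniq (k l) _ (hG l) (by rw [rG]; exact hjl.symm) (by rw [rG]; exact hml.symm)
  have f5 := huniq (k l) _ (hG' l) (by rw [rG']; exact hjl.symm) (by rw [rG']; exact hml.symm)
  have f6 := huniq l _ (hG (k (k l))) (by rw [rG]; exact hml) (by rw [rG]; exact hmj)
  have v1 := diff _ (hG (k (k l))) _ (hG (k l)) (by rw [rG, rG]; exact hmj)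
  have v2 := diff _ (hG (k (k l))) _ (hG' (k l)) (by rw [rG, rG']; exact hmj)
  have v3 := diff _ (hG (k l)) _ (hG l) (by rw [rG, rG]; exact hjl)
  have v4 := diff _ (hG (k l)) _ (hG' l) (by rw [rG, rG']; exact hjl)
  have v5 := diff _ (hG (k (k l))) _ (hG l) (by rw [rG, rG]; exact hml)
  have cyc : ∀ p ∈ S, ∀ g ∈ S, ∀ h ∈ S, ¬ (om p g = 1 ∧ om g h = 1 ∧ om p h = 3) ∧
      ¬ (om p g = 3 ∧ om g h = 3 ∧ om p h = 1) := by
    intro p hp g hg h hh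
    refine ⟨fun ⟨q1, q2, q3⟩ => nocyc p hp g hg h hh q1 q2 (by rw [om_swap, q3]; decide),
      fun ⟨q1, q2, q3⟩ => nocyc p hp h hh g hg q3 (by rw [om_swap, q2]; decide)
        (by rw [om_swap, q1]; decide)⟩
  have w1 := cyc _ (hG (k (k l))) _ (hG (k l)) _ (hG l)
  have w2 := cyc _ (hG (k (k l))) _ (hG (k l)) _ (hG' l)
  have w3 := cyc _ (hG (k (k l))) _ (hG' (k l)) _ (hG l)
  have w4 := cyc _ (hG (k (k l))) _ (hG' (k l)) _ (hG' l)
  have g1 : om (G' (k l)) (G l) = om (G (k l)) (G l) := by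
    rw [om_swap, ← f4, ← om_swap]
  have g2 : om (G' (k l)) (G' l) = om (G (k l)) (G' l) := by
    rw [om_swap, ← f5, ← om_swap]
  rw [g1] at w3
  rw [g2] at w4
  rw [← f6] at w2 w4
  clear f4 f5 f6 g1 g2
  revert f1 f2 v1 v2 v3 v4 v5 w1 w2 w3 w4
  generalize om (G (k (k l))) (G (k l)) = a
  generalize om (G (k (k l))) (G' (k l)) = b
  generalize om (G (k l)) (G l) = c
  generalize om (G (k l)) (G' l) = d
  generalize om (G (k (k l))) (G l) = e
  exact fun f1 f2 v1 v2 v3 v4 v5 w1 w2 w3 w4 => fin_case a b c d e f1 f2 v1 v2 v3 v4 v5 w1 w2 w3 w4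

end Kum


namespace Kum
open MvPolynomial

/-- exponents modulo 4 -/
def hat {n : ℕ} (d : Fin n × Bool →₀ ℕ) : Fin n × Bool → ZMod 4 := fun i => (d i : ZMod 4)

/-- the cocycle exponent -/
def tau {n : ℕ} (d e : Fin n × Bool →₀ ℕ) : ℕ := ∑ k, d (k, true) * e (k, false)

/-- standard representative of a class mod 4 -/
noncomputable def toN {n : ℕ} (r : Fin n × Bool → ZMod 4) : Fin n × Bool →₀ ℕ :=
  Finsupp.equivFunOnFinite.symm fun i => (r i).val

section
variable {n : ℕ}

lemma toN_apply (r : Fin n × Bool → ZMod 4) (i) : toN r i = (r i).val := rfl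

lemma hat_toN (r : Fin n × Bool → ZMod 4) : hat (toN r) = r := by
  funext i; simp [hat, toN_apply]

lemma hat_add (d e : Fin n × Bool →₀ ℕ) : hat (d + e) = hat d + hat e := by
  funext i; simp [hat]

lemma exists_four (D : Fin n × Bool →₀ ℕ) : ∃ d : Fin n × Bool →₀ ℕ, D = 4 • d + toN (hat D) := by
  refine ⟨Finsupp.equivFunOnFinite.symm fun i => D i / 4, ?_⟩
  ext i
  simp only [Finsupp.add_apply, Finsupp.smul_apply, toN_apply, hat, ZMod.val_natCast,
    Finsupp.equivFunOnFinite_symm_apply_apply, smul_eq_mul]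
  omega

lemma tau_add_left (d d' e : Fin n × Bool →₀ ℕ) : tau (d + d') e = tau d e + tau d' e := by
  simp [tau, add_mul, Finset.sum_add_distrib]

lemma tau_add_right (d e e' : Fin n × Bool →₀ ℕ) : tau d (e + e') = tau d e + tau d e' := by
  simp [tau, mul_add, Finset.sum_add_distrib]

lemma tau_smul_left (m : ℕ) (d e : Fin n × Bool →₀ ℕ) : tau (m • d) e = m * tau d e := by
  simp [tau, Finset.mul_sum, mul_assoc]

lemma om_hat (d e : Fin n × Bool →₀ ℕ) : om (hat d) (hat e) = (tau d e : ZMod 4) - tau e d := by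
  simp only [om, hat, tau, Nat.cast_sum, Nat.cast_mul, ← Finset.sum_sub_distrib]
  exact Finset.sum_congr rfl fun k _ => by ring

lemma pow_mod_four {K : Type*} [Field K] {j : K} (hj : j ^ 2 = -1) {a b : ℕ}
    (h : (a : ZMod 4) = b) : j ^ a = j ^ b := by
  have h4 : j ^ 4 = 1 := by rw [show 4 = 2 * 2 from rfl, pow_mul, hj]; norm_num
  rw [ZMod.natCast_eq_natCast_iff'] at h
  rw [← Nat.div_add_mod a 4, ← Nat.div_add_mod b 4, h, pow_add, pow_add, pow_mul, pow_mul, h4]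
  simp

lemma B_swap {K : Type*} [Field K] {j : K} (hj : j ^ 2 = -1) (d e : Fin n × Bool →₀ ℕ) (m : ℕ)
    (h : om (hat d) (hat e) = m) : j ^ tau d e = j ^ tau e d * j ^ m := by
  rw [← pow_add]
  apply pow_mod_four hj
  rw [om_hat] at h
  push_cast
  rw [← h]; ring
end

/-- The data of a twisted polynomial ring inside an algebra. -/
structure Tw {K : Type*} [Field K] {n : ℕ} {A : Type*} [Ring A] [Algebra K A] (j : K)
    (ψ : MvPolynomial (Fin n × Bool) K →ₐ[K] A) (M : (Fin n × Bool →₀ ℕ) → A) : Prop where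
  hj : j ^ 2 = -1
  zero : M 0 = 1
  mul : ∀ d e, M d * M e = j ^ tau d e • M (d + e)
  four : ∀ d, M (4 • d) = ψ (monomial d 1)

section
variable {K : Type*} [Field K] {n : ℕ} {A : Type*} [Ring A] [Algebra K A] {j : K}
    {ψ : MvPolynomial (Fin n × Bool) K →ₐ[K] A} {M : (Fin n × Bool →₀ ℕ) → A}

lemma Tw.four_add (T : Tw j ψ M) (d e) : M (4 • d + e) = ψ (monomial d 1) * M e := by
  rw [← T.four, T.mul, tau_smul_left, pow_mul, show j ^ 4 = 1 by
    rw [show 4 = 2 * 2 from rfl, pow_mul, T.hj]; norm_num, one_pow, one_smul]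

/-- the linear map from polynomials -/
noncomputable def Phi (M : (Fin n × Bool →₀ ℕ) → A) : MvPolynomial (Fin n × Bool) K →ₗ[K] A :=
  (basisMonomials (Fin n × Bool) K).constr K M

lemma Phi_monomial (d : Fin n × Bool →₀ ℕ) (c : K) : Phi M (monomial d c) = c • M d := by
  have h : monomial d c = c • basisMonomials (Fin n × Bool) K d := by
    simp [smul_monomial]
  rw [h, map_smul, Phi, Module.Basis.constr_basis]

lemma Tw.Phi_expand (T : Tw j ψ M) (q f : MvPolynomial (Fin n × Bool) K) :
    Phi M (expand 4 q * f) = ψ q * Phi M f := by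
  induction q using MvPolynomial.induction_on' with
  | add p q hp hq => rw [map_add, map_add, add_mul, add_mul, map_add, hp, hq]
  | monomial d c =>
    induction f using MvPolynomial.induction_on' with
    | add p q hp hq => rw [mul_add, map_add, map_add, mul_add, hp, hq]
    | monomial e c' =>
      have : monomial d c = c • monomial d 1 := by simp [smul_monomial]
      rw [expand_monomial, monomial_mul, Phi_monomial, Phi_monomial, T.four_add, this,
        map_smul, smul_mul_assoc, mul_smul_comm, smul_smul]

lemma Tw.Phi_expand' (T : Tw j ψ M) (q : MvPolynomial (Fin n × Bool) K) :
    Phi M (expand 4 q) = ψ q := by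
  have := T.Phi_expand q 1
  rwa [mul_one, show (1 : MvPolynomial (Fin n × Bool) K) = monomial 0 1 from rfl, Phi_monomial,
    T.zero, one_smul, mul_one] at this

lemma exists_decomp (f : MvPolynomial (Fin n × Bool) K) :
    ∃ p : (Fin n × Bool → ZMod 4) → MvPolynomial (Fin n × Bool) K,
      f = ∑ r, expand 4 (p r) * monomial (toN r) 1 := by
  classical
  induction f using MvPolynomial.induction_on' with
  | add p q hp hq =>
    obtain ⟨a, ha⟩ := hp
    obtain ⟨b, hb⟩ := hq
    refine ⟨a + b, ?_⟩
    conv_lhs => rw [ha, hb]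
    rw [← Finset.sum_add_distrib]
    exact Finset.sum_congr rfl fun r _ => by rw [Pi.add_apply, map_add, add_mul]
  | monomial D c =>
    obtain ⟨d, hd⟩ := exists_four D
    refine ⟨Pi.single (hat D) (monomial d c), ?_⟩
    rw [Finset.sum_eq_single (hat D)]
    · rw [Pi.single_eq_same, expand_monomial, monomial_mul, mul_one, ← hd]
    · intro r _ hr
      rw [Pi.single_eq_of_ne hr, map_zero, zero_mul]
    · simp

lemma Tw.Phi_sum (T : Tw j ψ M) (p : (Fin n × Bool → ZMod 4) → MvPolynomial (Fin n × Bool) K) :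
    Phi M (∑ r, expand 4 (p r) * monomial (toN r) 1) = ∑ r, ψ (p r) * M (toN r) := by
  rw [map_sum]
  exact Finset.sum_congr rfl fun r _ => by rw [T.Phi_expand, Phi_monomial, one_smul]

/-- independence over the polynomial ring -/
def Ind (ψ : MvPolynomial (Fin n × Bool) K →ₐ[K] A) (M : (Fin n × Bool →₀ ℕ) → A) : Prop :=
  ∀ p : (Fin n × Bool → ZMod 4) → MvPolynomial (Fin n × Bool) K,
    ∑ r, ψ (p r) * M (toN r) = 0 → p = 0

lemma Tw.Phi_inj (T : Tw j ψ M) (I : Ind ψ M) :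
    Function.Injective (Phi M : MvPolynomial (Fin n × Bool) K →ₗ[K] A) := by
  rw [injective_iff_map_eq_zero]
  intro f hf
  obtain ⟨p, rfl⟩ := exists_decomp f
  rw [T.Phi_sum] at hf
  simp [I p hf]

lemma dvd_of_mem_expand {q : MvPolynomial (Fin n × Bool) K} {d : Fin n × Bool →₀ ℕ}
    (h : d ∈ (expand 4 q).support) (i) : 4 ∣ d i := by
  by_contra hc
  exact (mem_support_iff.1 h) (coeff_expand_of_not_dvd q hc)

variable (m : MonomialOrder (Fin n × Bool))

/-- lower order terms -/
def Lt (K : Type*) [Field K] {A : Type*} [Ring A] [Algebra K A]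
    (M : (Fin n × Bool →₀ ℕ) → A) (d : Fin n × Bool →₀ ℕ) : Submodule K A :=
  Submodule.span K (M '' {e | m.toSyn e < m.toSyn d})

/-- leading term -/
def IsLead (M : (Fin n × Bool →₀ ℕ) → A) (v : A) (d : Fin n × Bool →₀ ℕ) (c : K) : Prop :=
  v - c • M d ∈ Lt m K M d

variable {m}

lemma IsLead.add {v w : A} {d : Fin n × Bool →₀ ℕ} {c c' : K} (h : IsLead m M v d c)
    (h' : IsLead m M w d c') : IsLead m M (v + w) d (c + c') := by
  have := add_mem h h'
  unfold IsLead
  convert this using 1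
  rw [add_smul]; abel

lemma Tw.Lt_mul_Lt (T : Tw j ψ M) {a b : A} {d e : Fin n × Bool →₀ ℕ} (ha : a ∈ Lt m K M d)
    (hb : b ∈ Lt m K M e) : a * b ∈ Lt m K M (d + e) := by
  have h : Lt m K M d * Lt m K M e ≤ Lt m K M (d + e) := by
    unfold Lt
    rw [Submodule.span_mul_span, Submodule.span_le]
    rintro _ ⟨_, ⟨x, hx, rfl⟩, _, ⟨y, hy, rfl⟩, rfl⟩
    simp only [T.mul]
    refine Submodule.smul_mem _ _ (Submodule.subset_span ⟨_, ?_, rfl⟩)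
    simp only [Set.mem_ofPred_eq, map_add] at *
    exact add_lt_add hx hy
  exact h (Submodule.mul_mem_mul ha hb)

lemma Tw.Lt_mul_M (T : Tw j ψ M) {a : A} {d e : Fin n × Bool →₀ ℕ} (ha : a ∈ Lt m K M d) :
    a * M e ∈ Lt m K M (d + e) := by
  have h : Lt m K M d * Submodule.span K {M e} ≤ Lt m K M (d + e) := by
    unfold Lt
    rw [Submodule.span_mul_span, Submodule.span_le]
    rintro _ ⟨_, ⟨x, hx, rfl⟩, _, rfl, rfl⟩
    simp only [T.mul]
    refine Submodule.smul_mem _ _ (Submodule.subset_span ⟨_, ?_, rfl⟩)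
    simp only [Set.mem_ofPred_eq, map_add] at *
    exact add_lt_add_left hx _
  exact h (Submodule.mul_mem_mul ha (Submodule.mem_span_singleton_self _))

lemma Tw.M_mul_Lt (T : Tw j ψ M) {a : A} {d e : Fin n × Bool →₀ ℕ} (ha : a ∈ Lt m K M d) :
    M e * a ∈ Lt m K M (e + d) := by
  have h : Submodule.span K {M e} * Lt m K M d ≤ Lt m K M (e + d) := by
    unfold Lt
    rw [Submodule.span_mul_span, Submodule.span_le]
    rintro _ ⟨_, rfl, _, ⟨x, hx, rfl⟩, rfl⟩
    simp only [T.mul]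
    refine Submodule.smul_mem _ _ (Submodule.subset_span ⟨_, ?_, rfl⟩)
    simp only [Set.mem_ofPred_eq, map_add] at *
    exact add_lt_add_right hx _
  exact h (Submodule.mul_mem_mul (Submodule.mem_span_singleton_self _) ha)

lemma Tw.isLead_mul (T : Tw j ψ M) {v w : A} {d e : Fin n × Bool →₀ ℕ} {c c' : K}
    (h : IsLead m M v d c) (h' : IsLead m M w e c') :
    IsLead m M (v * w) (d + e) (c * c' * j ^ tau d e) := by
  have h1 := T.Lt_mul_Lt h h'
  have h2 := Submodule.smul_mem _ c' (T.Lt_mul_M (e := e) h)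
  have h3 := Submodule.smul_mem _ c (T.M_mul_Lt (e := d) h')
  have := add_mem (add_mem h1 h2) h3
  unfold IsLead
  convert this using 1
  rw [mul_smul, ← T.mul, ← smul_mul_smul_comm, ← mul_smul_comm, ← smul_mul_assoc]
  noncomm_ring

lemma isLead_Phi (f : MvPolynomial (Fin n × Bool) K) :
    IsLead m M (Phi M f) (m.degree f) (m.leadingCoeff f) := by
  classical
  unfold IsLead
  by_cases hf : f = 0
  · simp [hf]
  have hs : Phi M f = ∑ v ∈ f.support, Phi M (monomial v (coeff v f)) := by
    rw [← map_sum, ← f.as_sum]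
  rw [hs, ← Finset.add_sum_erase _ _ (m.degree_mem_support hf), Phi_monomial,
    MonomialOrder.leadingCoeff, add_sub_cancel_left]
  refine Submodule.sum_mem _ fun e he => ?_
  rw [Phi_monomial]
  refine Submodule.smul_mem _ _ (Submodule.subset_span ⟨e, ?_, rfl⟩)
  refine lt_of_le_of_ne (m.le_degree (Finset.mem_of_mem_erase he)) fun h => ?_
  exact Finset.ne_of_mem_erase he (m.toSyn.injective h)

lemma exists_of_mem_Lt {a : A} {d : Fin n × Bool →₀ ℕ} (ha : a ∈ Lt m K M d) :
    ∃ f : MvPolynomial (Fin n × Bool) K, Phi M f = a ∧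
      ∀ e ∈ f.support, m.toSyn e < m.toSyn d := by
  classical
  induction ha using Submodule.span_induction with
  | mem x h =>
    obtain ⟨e, he, rfl⟩ := h
    refine ⟨monomial e 1, by rw [Phi_monomial, one_smul], fun e' he' => ?_⟩
    rw [Finset.mem_singleton.1 (support_monomial_subset he')]
    exact he
  | zero => exact ⟨0, by simp, by simp⟩
  | add x y _ _ hx hy =>
    obtain ⟨f, rfl, hf⟩ := hx
    obtain ⟨g, rfl, hg⟩ := hy
    refine ⟨f + g, by simp, fun e he => ?_⟩
    rcases Finset.mem_union.1 (support_add he) with h | h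
    · exact hf e h
    · exact hg e h
  | smul c x _ hx =>
    obtain ⟨f, rfl, hf⟩ := hx
    exact ⟨c • f, by simp, fun e he => hf e (support_smul he)⟩

lemma Tw.lead_dvd (T : Tw j ψ M) (I : Ind ψ M) {v : A} {d : Fin n × Bool →₀ ℕ} {c : K}
    (h : IsLead m M v d c) (hc : c ≠ 0) {p q : MvPolynomial (Fin n × Bool) K} (hq : q ≠ 0)
    (hv : ψ q * v = ψ p) (i) : 4 ∣ d i := by
  obtain ⟨f, hf, hfs⟩ := exists_of_mem_Lt h
  set g := f + monomial d c with hg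
  have hgv : Phi M g = v := by
    rw [hg, map_add, hf, Phi_monomial]; abel
  have hfd : f.coeff d = 0 := by
    by_contra hne
    exact lt_irrefl _ (hfs d (mem_support_iff.2 hne))
  have hgd : g.coeff d = c := by
    rw [hg, coeff_add, hfd, coeff_monomial, if_pos rfl, zero_add]
  have hg0 : g ≠ 0 := by
    intro h0; rw [h0] at hgd; exact hc (by simpa using hgd.symm)
  have hdeg : m.degree g = d := by
    apply m.toSyn.injective
    apply le_antisymm
    · rw [MonomialOrder.degree_le_iff]
      intro e he
      by_cases hed : e = d
      · rw [hed]
      · refine (hfs e (mem_support_iff.2 fun h0 => mem_support_iff.1 he ?_)).le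
        rw [hg, coeff_add, h0, coeff_monomial, if_neg (Ne.symm hed), zero_add]
    · exact m.le_degree (mem_support_iff.2 (by rw [hgd]; exact hc))
  have e1 : expand 4 q * g = expand 4 p := by
    apply T.Phi_inj I
    rw [T.Phi_expand, T.Phi_expand', hgv, hv]
  have hq' : expand 4 q ≠ 0 := (expand_ne_zero (by norm_num)).2 hq
  have hp' : expand 4 p ≠ 0 := by rw [← e1]; exact mul_ne_zero hq' hg0
  have e2 := m.degree_mul hq' hg0
  rw [e1, hdeg] at e2
  have e3 := dvd_of_mem_expand (m.degree_mem_support hq') i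
  have e4 := dvd_of_mem_expand (m.degree_mem_support hp') i
  rw [e2, Finsupp.add_apply] at e4
  exact (Nat.dvd_add_right e3).1 e4

end

section
variable {A : Type*} [Ring A]

/-- the (2,1,1) part of the fourth power -/
def P3 (g h k : A) : A :=
  g*g*h*k + g*g*k*h + g*h*g*k + g*k*g*h + h*g*g*k + k*g*g*h +
  g*h*k*g + g*k*h*g + h*g*k*g + k*g*h*g + h*k*g*g + k*h*g*g

set_option maxHeartbeats 1600000 in
lemma P3_polar (g h k : A) : P3 g h k + P3 g h k =
    (((g + h + k) ^ 4 - (g + h) ^ 4 - (g + k) ^ 4)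
    + ((h + k - g) ^ 4 - (h - g) ^ 4 - (k - g) ^ 4) + (g ^ 4 + g ^ 4))
    - ((h + k) ^ 4 - h ^ 4 - k ^ 4) - ((h + k) ^ 4 - h ^ 4 - k ^ 4) := by
  unfold P3
  simp only [pow_succ, pow_zero, one_mul, sub_eq_add_neg, mul_add, add_mul, neg_mul, mul_neg,
    neg_neg, neg_add]
  abel
end

section
variable {K : Type*} [Field K] {n : ℕ} {A : Type*} [Ring A] [Algebra K A] {j : K}
    {ψ : MvPolynomial (Fin n × Bool) K →ₐ[K] A} {M : (Fin n × Bool →₀ ℕ) → A}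
    {m : MonomialOrder (Fin n × Bool)}

lemma Tw.isLead_word (T : Tw j ψ M) {v1 v2 v3 v4 : A} {d1 d2 d3 d4 D : Fin n × Bool →₀ ℕ}
    {c1 c2 c3 c4 : K} (h1 : IsLead m M v1 d1 c1) (h2 : IsLead m M v2 d2 c2)
    (h3 : IsLead m M v3 d3 c3) (h4 : IsLead m M v4 d4 c4) (hD : D = d1 + d2 + d3 + d4) :
    IsLead m M (v1 * v2 * v3 * v4) D (c1 * c2 * c3 * c4 *
      (j ^ tau d1 d2 * j ^ tau d1 d3 * j ^ tau d1 d4 * j ^ tau d2 d3 * j ^ tau d2 d4 *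
        j ^ tau d3 d4)) := by
  have := T.isLead_mul (T.isLead_mul (T.isLead_mul h1 h2) h3) h4
  rw [hD]
  convert this using 1
  rw [tau_add_left, tau_add_left, tau_add_left, pow_add, pow_add, pow_add]
  ring

/-- leading coefficient of `P3` up to a unit -/
def kap {K : Type*} [Field K] (p q r s u w : K) : K :=
  p^2*r^2*u + p^2*r^2*w + p*q*r^2*u + p^2*r*s*w + q^2*r^2*u + p^2*s^2*w +
  p*q*r*s*u + p*q*r*s*w + q^2*r*s*u + p*q*s^2*w + q^2*s^2*u + q^2*s^2*w

lemma Tw.isLead_P3 (T : Tw j ψ M) {g h k : A} {dg dh dk : Fin n × Bool →₀ ℕ}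
    {a b c : K} (hg : IsLead m M g dg a) (hh : IsLead m M h dh b)
    (hk : IsLead m M k dk c) :
    IsLead m M (P3 g h k + P3 g h k) (dg + dg + dh + dk) (2 * (a * a * b * c * j ^ tau dg dg *
      kap (j ^ tau dg dh) (j ^ tau dh dg) (j ^ tau dg dk) (j ^ tau dk dg) (j ^ tau dh dk)
        (j ^ tau dk dh))) := by
  have h0 : IsLead m M (P3 g h k) (dg + dg + dh + dk) (a * a * b * c * j ^ tau dg dg *
      kap (j ^ tau dg dh) (j ^ tau dh dg) (j ^ tau dg dk) (j ^ tau dk dg) (j ^ tau dh dk)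
        (j ^ tau dk dh)) := by
    have := ((((((((((((T.isLead_word (D := dg + dg + dh + dk) hg hg hh hk (by abel)).add
      (T.isLead_word hg hg hk hh (by abel))).add
      (T.isLead_word hg hh hg hk (by abel))).add
      (T.isLead_word hg hk hg hh (by abel))).add
      (T.isLead_word hh hg hg hk (by abel))).add
      (T.isLead_word hk hg hg hh (by abel))).add
      (T.isLead_word hg hh hk hg (by abel))).add
      (T.isLead_word hg hk hh hg (by abel))).add
      (T.isLead_word hh hg hk hg (by abel))).add
      (T.isLead_word hk hg hh hg (by abel))).add
      (T.isLead_word hh hk hg hg (by abel))).add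
      (T.isLead_word hk hh hg hg (by abel)))
    unfold P3
    convert this using 1
    unfold kap
    ring
  rw [two_mul]
  exact h0.add h0

/-- Main leading-form lemma. -/
theorem Tw.lead_cond [CharZero K] (T : Tw j ψ M) (I : Ind ψ M) (W : AddSubgroup A) (R : Subring A)
    (hR : ∀ u ∈ R, ∃ p q : MvPolynomial (Fin n × Bool) K, q ≠ 0 ∧ ψ q * u = ψ p)
    (hW : ∀ v ∈ W, v ^ 4 ∈ R) {f g h : MvPolynomial (Fin n × Bool) K}
    (hf0 : f ≠ 0) (hg0 : g ≠ 0) (hh0 : h ≠ 0)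
    (hf : Phi M f ∈ W) (hg : Phi M g ∈ W) (hh : Phi M h ∈ W)
    (hk : kap (j ^ tau (m.degree f) (m.degree g)) (j ^ tau (m.degree g) (m.degree f))
      (j ^ tau (m.degree f) (m.degree h)) (j ^ tau (m.degree h) (m.degree f))
      (j ^ tau (m.degree g) (m.degree h)) (j ^ tau (m.degree h) (m.degree g)) ≠ 0) (i) :
    2 * hat (m.degree f) i + hat (m.degree g) i + hat (m.degree h) i = 0 := by
  have hj0 : j ≠ 0 := by
    rintro rfl
    have := T.hj
    norm_num at this
  have hmem : P3 (Phi M f) (Phi M g) (Phi M h) + P3 (Phi M f) (Phi M g) (Phi M h) ∈ R := by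
    rw [P3_polar]
    have a1 := hW _ (add_mem (add_mem hf hg) hh)
    have a2 := hW _ (add_mem hf hg)
    have a3 := hW _ (add_mem hf hh)
    have b1 := hW _ (sub_mem (add_mem hg hh) hf)
    have b2 := hW _ (sub_mem hg hf)
    have b3 := hW _ (sub_mem hh hf)
    have c1 := hW _ hf
    have c2 := hW _ (add_mem hg hh)
    have c3 := hW _ hg
    have c4 := hW _ hh
    have d1 := sub_mem (sub_mem c2 c3) c4
    exact sub_mem (sub_mem (add_mem (add_mem (sub_mem (sub_mem a1 a2) a3)
      (sub_mem (sub_mem b1 b2) b3)) (add_mem c1 c1)) d1) d1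
  obtain ⟨p, q, hq, hpq⟩ := hR _ hmem
  have hl := T.isLead_P3 (isLead_Phi (m := m) (M := M) f) (isLead_Phi (m := m) (M := M) g)
    (isLead_Phi (m := m) (M := M) h)
  have := T.lead_dvd I hl (by
    have l1 := m.leadingCoeff_ne_zero_iff.2 hf0
    have l2 := m.leadingCoeff_ne_zero_iff.2 hg0
    have l3 := m.leadingCoeff_ne_zero_iff.2 hh0
    have l4 := pow_ne_zero (tau (m.degree f) (m.degree f)) hj0
    exact mul_ne_zero two_ne_zero (mul_ne_zero (mul_ne_zero (mul_ne_zero (mul_ne_zero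
      (mul_ne_zero l1 l1) l2) l3) l4) hk)) hq hpq i
  rw [← ZMod.natCast_eq_zero_iff] at this
  rw [← this]
  simp only [hat, Finsupp.add_apply]
  push_cast
  ring

/-- The exponents of leading forms satisfy the combinatorial conditions. -/
theorem Tw.KS [CharZero K] (T : Tw j ψ M) (I : Ind ψ M) (W : AddSubgroup A) (R : Subring A)
    (hR : ∀ u ∈ R, ∃ p q : MvPolynomial (Fin n × Bool) K, q ≠ 0 ∧ ψ q * u = ψ p)
    (hW : ∀ v ∈ W, v ^ 4 ∈ R) (S : Finset (Fin n × Bool → ZMod 4))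
    (hS : ∀ r ∈ S, ∃ f : MvPolynomial (Fin n × Bool) K, f ≠ 0 ∧ Phi M f ∈ W ∧
      hat (m.degree f) = r) : KS S := by
  have hj := T.hj
  have hj0 : j ≠ 0 := by
    rintro rfl
    norm_num at hj
  have hj1 : 1 + j ≠ 0 := by
    intro h
    have h1 : j = -1 := by linear_combination h
    rw [h1] at hj
    norm_num at hj
  have hB : ∀ d e : Fin n × Bool →₀ ℕ, j ^ tau d e ≠ 0 := fun d e => pow_ne_zero _ hj0
  have p2 : j ^ 2 = -1 := hj
  have p3 : j ^ 3 = -j := by rw [pow_succ, p2]; ring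
  have p4 : j ^ 4 = 1 := by rw [pow_succ, p3]; linear_combination -hj
  have p5 : j ^ 5 = j := by rw [pow_succ, p4]; ring
  have p6 : j ^ 6 = -1 := by rw [pow_succ, p5]; linear_combination hj
  have p7 : j ^ 7 = -j := by rw [pow_succ, p6]; ring
  have p8 : j ^ 8 = 1 := by rw [pow_succ, p7]; linear_combination -hj
  have p9 : j ^ 9 = j := by rw [pow_succ, p8]; ring
  have p10 : j ^ 10 = -1 := by rw [pow_succ, p9]; linear_combination hj
  constructor
  · intro r hr s hs hne h0
    obtain ⟨f, hf0, hf, rfl⟩ := hS r hr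
    obtain ⟨g, hg0, hg, rfl⟩ := hS s hs
    have e1 := B_swap hj _ _ 0 (h0.trans (by simp))
    have := T.lead_cond (m := m) I W R hR hW hf0 hf0 hg0 hf hf hg (by
      rw [e1, pow_zero, mul_one]
      have : kap (j ^ tau (m.degree f) (m.degree f)) (j ^ tau (m.degree f) (m.degree f))
        (j ^ tau (m.degree g) (m.degree f)) (j ^ tau (m.degree g) (m.degree f))
        (j ^ tau (m.degree g) (m.degree f)) (j ^ tau (m.degree g) (m.degree f)) =
        12 * ((j ^ tau (m.degree f) (m.degree f)) ^ 2 *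
          (j ^ tau (m.degree g) (m.degree f)) ^ 3) := by
        unfold kap; ring
      rw [this]
      exact mul_ne_zero (by norm_num) (mul_ne_zero (pow_ne_zero _ (hB _ _))
        (pow_ne_zero _ (hB _ _))))
    apply hne
    funext i
    have h1 := this i
    revert h1
    generalize hat (m.degree f) i = a
    generalize hat (m.degree g) i = b
    revert a b
    decide
  · intro r hr s hs h0 i
    obtain ⟨f, hf0, hf, rfl⟩ := hS r hr
    obtain ⟨g, hg0, hg, rfl⟩ := hS s hs
    have e1 := B_swap hj _ _ 2 (h0.trans (by norm_num))
    have := T.lead_cond (m := m) I W R hR hW hf0 hg0 hg0 hf hg hg (by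
      rw [e1, hj]
      generalize j ^ tau (m.degree f) (m.degree f) = a
      have hb := hB (m.degree g) (m.degree f)
      have hc := hB (m.degree g) (m.degree g)
      revert hb hc
      generalize j ^ tau (m.degree g) (m.degree f) = b
      generalize j ^ tau (m.degree g) (m.degree g) = c
      intro hb hc
      have : kap (b * -1) b (b * -1) b c c = 4 * (b ^ 4 * c) := by unfold kap; ring
      rw [this]
      exact mul_ne_zero (by norm_num) (mul_ne_zero (pow_ne_zero _ hb) hc)) i
    rw [← this]; ring
  · intro r hr s hs t ht h1 h2 h3 i
    obtain ⟨f, hf0, hf, rfl⟩ := hS r hr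
    obtain ⟨g, hg0, hg, rfl⟩ := hS s hs
    obtain ⟨h, hh0, hh, rfl⟩ := hS t ht
    have e1 := B_swap hj _ _ 1 (h1.trans (by norm_num))
    have e2 := B_swap hj _ _ 1 (h2.trans (by norm_num))
    have e3 := B_swap hj _ _ 1 (h3.trans (by norm_num))
    refine T.lead_cond (m := m) I W R hR hW hf0 hg0 hh0 hf hg hh ?_ i
    rw [e1, e2, e3, pow_one]
    have hb := hB (m.degree g) (m.degree f)
    have hc := hB (m.degree h) (m.degree g)
    have hd := hB (m.degree f) (m.degree h)
    revert hb hc hd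
    generalize j ^ tau (m.degree g) (m.degree f) = b
    generalize j ^ tau (m.degree h) (m.degree g) = c
    generalize j ^ tau (m.degree f) (m.degree h) = d
    intro hb hc hd
    have : kap (b * j) b d (d * j) (c * j) c = -4 * (1 + j) * (b ^ 2 * c * d ^ 2) := by
      unfold kap
      ring_nf
      simp only [p2, p3, p4, p5, p6, p7, p8, p9, p10]
      ring
    rw [this]
    exact mul_ne_zero (mul_ne_zero (by norm_num) hj1)
      (mul_ne_zero (mul_ne_zero (pow_ne_zero _ hb) hc) (pow_ne_zero _ hd))
  · intro r hr s hs t ht h1 h2 h3 i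
    obtain ⟨f, hf0, hf, rfl⟩ := hS r hr
    obtain ⟨g, hg0, hg, rfl⟩ := hS s hs
    obtain ⟨h, hh0, hh, rfl⟩ := hS t ht
    have e1 := B_swap hj _ _ 2 (h1.trans (by norm_num))
    have e2 := B_swap hj _ _ 1 (h2.trans (by norm_num))
    have e3 := B_swap hj _ _ 3 (h3.trans (by norm_num))
    refine T.lead_cond (m := m) I W R hR hW hf0 hg0 hh0 hf hg hh ?_ i
    rw [e1, e2, e3, pow_one]
    have hb := hB (m.degree g) (m.degree f)
    have hc := hB (m.degree h) (m.degree g)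
    have hd := hB (m.degree h) (m.degree f)
    revert hb hc hd
    generalize j ^ tau (m.degree g) (m.degree f) = b
    generalize j ^ tau (m.degree h) (m.degree g) = c
    generalize j ^ tau (m.degree h) (m.degree f) = d
    intro hb hc hd
    have : kap (b * j) b (d * j ^ 3) d (c * j ^ 2) c = 4 * j * (b ^ 2 * c * d ^ 2) := by
      unfold kap
      ring_nf
      simp only [p2, p3, p4, p5, p6, p7, p8, p9, p10]
      ring
    rw [this]
    exact mul_ne_zero (mul_ne_zero (by norm_num) hj0)
      (mul_ne_zero (mul_ne_zero (pow_ne_zero _ hb) hc) (pow_ne_zero _ hd))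

end
end Kum


namespace Kum
open MvPolynomial

section
variable {K : Type*} [Field K] {A : Type*} [Ring A] [Algebra K A]

lemma prod_ofFn_mul {n : ℕ} (f g h : Fin n → A) (c : Fin n → K)
    (hfg : ∀ k, f k * g k = c k • h k) (comm : ∀ k l, k ≠ l → Commute (f k) (g l)) :
    (List.ofFn f).prod * (List.ofFn g).prod = (∏ k, c k) • (List.ofFn h).prod := by
  induction n with
  | zero => simp
  | succ n ih =>
    rw [List.ofFn_succ, List.ofFn_succ, List.ofFn_succ, List.prod_cons, List.prod_cons,
      List.prod_cons, Fin.prod_univ_succ]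
    have hc : Commute (List.ofFn fun i : Fin n => f i.succ).prod (g 0) := by
      apply Commute.list_prod_left
      intro z hz
      obtain ⟨i, rfl⟩ := (List.mem_ofFn' _ _).1 hz
      exact comm _ _ (Fin.succ_ne_zero i)
    have := ih (fun i => f i.succ) (fun i => g i.succ) (fun i => h i.succ) (fun i => c i.succ)
      (fun k => hfg _) (fun k l hkl => comm _ _ fun e => hkl (Fin.succ_injective _ e))
    rw [mul_assoc, ← mul_assoc _ (g 0), hc.eq, mul_assoc, this, ← mul_assoc, hfg,
      smul_mul_smul_comm]

lemma prod_ofFn_one {n : ℕ} (f : Fin n → A) (hf : ∀ k, f k = 1) : (List.ofFn f).prod = 1 := by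
  apply List.prod_eq_one
  intro z hz
  obtain ⟨i, rfl⟩ := (List.mem_ofFn' _ _).1 hz
  exact hf i

lemma prod_ofFn_single {n : ℕ} (f : Fin n → A) (k : Fin n) (hf : ∀ l, l ≠ k → f l = 1) :
    (List.ofFn f).prod = f k := by
  induction n with
  | zero => exact k.elim0
  | succ n ih =>
    rw [List.ofFn_succ, List.prod_cons]
    induction k using Fin.cases with
    | zero => rw [prod_ofFn_one _ fun i => hf _ (Fin.succ_ne_zero i), mul_one]
    | succ k =>
      rw [hf 0 (Fin.succ_ne_zero k).symm, one_mul]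
      exact ih (fun i => f i.succ) k fun l hl => hf _ fun e => hl (Fin.succ_injective _ e)

lemma qpow {j : K} {x y : A} (h : y * x = j • (x * y)) (b c : ℕ) :
    y ^ b * x ^ c = j ^ (b * c) • (x ^ c * y ^ b) := by
  have h1 : ∀ c : ℕ, y * x ^ c = j ^ c • (x ^ c * y) := by
    intro c
    induction c with
    | zero => simp
    | succ c ih =>
      rw [pow_succ, ← mul_assoc, ih, smul_mul_assoc, mul_assoc, h, mul_smul_comm, smul_smul,
        ← mul_assoc, pow_succ]
  induction b with
  | zero => simp
  | succ b ih =>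
    rw [pow_succ, mul_assoc, h1, mul_smul_comm, ← mul_assoc, ih, smul_mul_assoc, smul_smul,
      mul_assoc, ← pow_succ, ← pow_add]
    congr 2; ring

/-- ordered monomials -/
def Mon {n : ℕ} (x y : Fin n → A) (d : Fin n × Bool →₀ ℕ) : A :=
  (List.ofFn fun k => x k ^ d (k, false) * y k ^ d (k, true)).prod

section
variable {n : ℕ} {x y : Fin n → A}

lemma Mon_zero : Mon x y 0 = 1 := prod_ofFn_one _ fun k => by simp

lemma Mon_x (k : Fin n) (t : ℕ) : Mon x y (Finsupp.single (k, false) t) = x k ^ t := by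
  unfold Mon
  rw [prod_ofFn_single _ k]
  · simp
  · intro l hl
    simp [Finsupp.single_apply, hl.symm]

lemma Mon_y (k : Fin n) (t : ℕ) : Mon x y (Finsupp.single (k, true) t) = y k ^ t := by
  unfold Mon
  rw [prod_ofFn_single _ k]
  · simp
  · intro l hl
    simp [Finsupp.single_apply, hl.symm]

lemma Mon_mul {j : K} (hxy : ∀ k, y k * x k = j • (x k * y k))
    (hxx : ∀ k l, k ≠ l → Commute (x k) (x l))
    (hyy : ∀ k l, k ≠ l → Commute (y k) (y l))
    (hxyc : ∀ k l, k ≠ l → Commute (x k) (y l)) (d e : Fin n × Bool →₀ ℕ) :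
    Mon x y d * Mon x y e = j ^ tau d e • Mon x y (d + e) := by
  unfold Mon tau
  rw [← Finset.prod_pow_eq_pow_sum]
  apply prod_ofFn_mul
  · intro k
    rw [mul_assoc, ← mul_assoc (y k ^ _), qpow (hxy k), smul_mul_assoc, mul_smul_comm,
      Finsupp.add_apply, Finsupp.add_apply, pow_add, pow_add]
    simp only [mul_assoc]
  · intro k l hkl
    exact Commute.mul_left
      (((hxx k l hkl).pow_pow _ _).mul_right ((hxyc k l hkl).pow_pow _ _))
      ((((hxyc l k hkl.symm).symm).pow_pow _ _).mul_right ((hyy k l hkl).pow_pow _ _))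

theorem Mon_Tw {j : K} (hj : j ^ 2 = -1) (hxy : ∀ k, y k * x k = j • (x k * y k))
    (hxx : ∀ k l, k ≠ l → Commute (x k) (x l))
    (hyy : ∀ k l, k ≠ l → Commute (y k) (y l))
    (hxyc : ∀ k l, k ≠ l → Commute (x k) (y l))
    (ψ : MvPolynomial (Fin n × Bool) K →ₐ[K] A)
    (hx4 : ∀ k, x k ^ 4 = ψ (X (k, false))) (hy4 : ∀ k, y k ^ 4 = ψ (X (k, true))) :
    Tw j ψ (Mon x y) := by
  have hmul := Mon_mul hxy hxx hyy hxyc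
  refine ⟨hj, Mon_zero, hmul, fun d => ?_⟩
  induction d using Finsupp.induction_linear with
  | zero =>
    rw [smul_zero, Mon_zero]
    exact (map_one ψ).symm
  | add f g hf hg =>
    have h4 : j ^ 4 = 1 := by rw [show 4 = 2 * 2 from rfl, pow_mul, hj]; norm_num
    have := hmul (4 • f) (4 • g)
    rw [tau_smul_left, pow_mul, h4, one_pow, one_smul, hf, hg, ← map_mul, monomial_mul, one_mul,
      ← smul_add] at this
    exact this.symm
  | single s t =>
    rw [Finsupp.smul_single, smul_eq_mul]
    have : (monomial (Finsupp.single s t) (1 : K)) = X s ^ t := by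
      rw [X_pow_eq_monomial]
    rw [this, map_pow]
    rcases s with ⟨k, _ | _⟩
    · rw [Mon_x, pow_mul, hx4]
    · rw [Mon_y, pow_mul, hy4]
end

lemma qadd_pow {j : K} (hj : j ^ 2 = -1) {u v : A} (h : u * v = j • (v * u)) :
    (u + v) ^ 4 = u ^ 4 + v ^ 4 := by
  have h' : ∀ z, u * (v * z) = j • (v * (u * z)) := fun z => by
    rw [← mul_assoc, h, smul_mul_assoc, mul_assoc]
  simp only [pow_succ, pow_zero, one_mul, mul_add, add_mul, mul_assoc, h, h', mul_smul_comm,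
    smul_mul_assoc, smul_add, smul_smul]
  match_scalars <;>
    first
    | ring1
    | linear_combination (1 + j) * hj
    | linear_combination (1 + j + j ^ 2) * hj

lemma qsum_pow {j : K} (hj : j ^ 2 = -1) {n : ℕ} (u : Fin n → A) (w : A)
    (h : ∀ k l, k < l → u k * u l = j • (u l * u k)) (hw : ∀ k, u k * w = j • (w * u k)) :
    (w + ∑ k, u k) ^ 4 = w ^ 4 + ∑ k, u k ^ 4 := by
  induction n with
  | zero => simp
  | succ n ih =>
    rw [Fin.sum_univ_succ, Fin.sum_univ_succ, add_left_comm, qadd_pow hj,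
      ih (fun k => u k.succ) (fun k l hkl => h _ _ (Fin.succ_lt_succ_iff.2 hkl)) fun k => hw _]
    · abel
    · rw [mul_add, hw, Finset.mul_sum, add_mul, smul_add, Finset.sum_mul, Finset.smul_sum]
      congr 1
      exact Finset.sum_congr rfl fun k _ => h _ _ (Fin.succ_pos k)
end

section
variable {F : Type*} [Field F] {A : Type*} [Ring A] [Algebra F A]
open Polynomial in
lemma norm_pow {j : F} (hj : j ^ 2 = -1) {x y : A} {α β : F} (hx : x ^ 4 = algebraMap F A α)
    (hy : y ^ 4 = algebraMap F A β) (h : y * x = j • (x * y)) (a : Fin 4 → F) :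
    (∑ t, a t • (x ^ (t : ℕ) * y)) ^ 4 ∈ Set.range (algebraMap F A) := by
  set p : F → F[X] := fun c => Polynomial.C (a 0) + Polynomial.C (a 1 * c) * Polynomial.X
    + Polynomial.C (a 2 * c ^ 2) * Polynomial.X ^ 2
    + Polynomial.C (a 3 * c ^ 3) * Polynomial.X ^ 3 with hp
  have e0 : ∑ t, a t • (x ^ (t : ℕ) * y) = aeval x (p 1) * y := by
    simp [hp, Fin.sum_univ_four, Algebra.smul_def, add_mul, mul_assoc]
  have hyx : ∀ c : ℕ, y * x ^ c = j ^ c • (x ^ c * y) := by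
    intro c
    have := qpow h 1 c
    simpa using this
  have ea : ∀ c, aeval x (p c) = a 0 • (1 : A) + (a 1 * c) • x + (a 2 * c ^ 2) • x ^ 2
      + (a 3 * c ^ 3) • x ^ 3 := by
    intro c
    simp [hp, Algebra.smul_def]
  have e1 : ∀ c, y * aeval x (p c) = aeval x (p (c * j)) * y := by
    intro c
    have h1 := hyx 1
    rw [pow_one, pow_one] at h1
    rw [ea, ea]
    simp only [mul_add, add_mul, mul_smul_comm, smul_mul_assoc, hyx, h1, smul_smul, mul_one,
      one_mul, mul_pow, mul_assoc]
  have e2 : (aeval x (p 1) * y) ^ 4 =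
      aeval x (p 1 * p j * p (j ^ 2) * p (j ^ 3)) * y ^ 4 := by
    have f1 := e1 1
    have f2 := e1 j
    have f3 := e1 (j ^ 2)
    rw [one_mul] at f1
    rw [← pow_two] at f2
    rw [← pow_succ] at f3
    simp only [pow_succ, pow_zero, one_mul, map_mul] at *
    generalize aeval x (p 1) = p0 at *
    generalize aeval x (p j) = p1 at *
    generalize aeval x (p (j * j)) = p2 at *
    generalize aeval x (p (j * j * j)) = p3 at *
    calc p0 * y * (p0 * y) * (p0 * y) * (p0 * y)
        = p0 * (y * p0) * (y * p0) * (y * p0) * y := by noncomm_ring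
      _ = p0 * p1 * (y * p1) * (y * p1) * (y * y) := by rw [f1]; noncomm_ring
      _ = p0 * p1 * p2 * (y * p2) * (y * y * y) := by rw [f2]; noncomm_ring
      _ = _ := by rw [f3]; noncomm_ring
  have e3 : p 1 * p j * p (j ^ 2) * p (j ^ 3) =
      (Polynomial.C (a 0 ^ 2) + Polynomial.C (a 2 ^ 2 - 2 * a 1 * a 3) * Polynomial.X ^ 4) ^ 2 -
      Polynomial.X ^ 4 * (Polynomial.C (2 * a 0 * a 2 - a 1 ^ 2) -
        Polynomial.C (a 3 ^ 2) * Polynomial.X ^ 4) ^ 2 := by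
    have p2 : Polynomial.C j ^ 2 = -1 := by rw [← map_pow, hj]; simp
    have p3 : Polynomial.C j ^ 3 = -Polynomial.C j := by rw [pow_succ, p2]; ring
    have g1 : p 1 * p (j ^ 2) = (Polynomial.C (a 0 ^ 2) +
        Polynomial.C (a 2 ^ 2 - 2 * a 1 * a 3) * Polynomial.X ^ 4) + Polynomial.X ^ 2 *
        (Polynomial.C (2 * a 0 * a 2 - a 1 ^ 2) - Polynomial.C (a 3 ^ 2) * Polynomial.X ^ 4) := by
      simp only [hp, hj, map_mul, map_pow, map_sub, map_one, map_neg, map_ofNat]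
      ring
    have g2 : p j * p (j ^ 3) = (Polynomial.C (a 0 ^ 2) +
        Polynomial.C (a 2 ^ 2 - 2 * a 1 * a 3) * Polynomial.X ^ 4) - Polynomial.X ^ 2 *
        (Polynomial.C (2 * a 0 * a 2 - a 1 ^ 2) - Polynomial.C (a 3 ^ 2) * Polynomial.X ^ 4) := by
      have j3 : j ^ 3 = -j := by rw [pow_succ, hj]; ring
      simp only [hp, j3, neg_sq, hj, map_mul, map_pow, map_sub, map_one, map_neg, map_ofNat,
        Odd.neg_pow (show Odd 3 by decide)]
      generalize Polynomial.C (a 0) = a0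
      generalize Polynomial.C (a 1) = a1
      generalize Polynomial.C (a 2) = a2
      generalize Polynomial.C (a 3) = a3
      generalize Polynomial.C j = c at *
      linear_combination (2 * a0 * a2 * Polynomial.X ^ 2
        + (a2 ^ 2 - 2 * a1 * a3) * Polynomial.X ^ 4 * (c ^ 2 - 1) - a1 ^ 2 * Polynomial.X ^ 2
        - a3 ^ 2 * Polynomial.X ^ 6 * (c ^ 4 - c ^ 2 + 1)) * p2
    calc _ = (p 1 * p (j ^ 2)) * (p j * p (j ^ 3)) := by ring
      _ = _ := by rw [g1, g2]; ring
  rw [e0, e2, hy, e3]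
  refine ⟨((a 0 ^ 2 + (a 2 ^ 2 - 2 * a 1 * a 3) * α) ^ 2 - α * ((2 * a 0 * a 2 - a 1 ^ 2)
    - a 3 ^ 2 * α) ^ 2) * β, ?_⟩
  simp only [map_mul, map_add, map_sub, map_pow, Polynomial.aeval_C, Polynomial.aeval_X, hx]
end
end Kum

namespace Kum
open MvPolynomial

lemma nonempty_order (σ : Type) [Fintype σ] : Nonempty (MonomialOrder.{0, 0} σ) := by
  letI : LinearOrder σ :=
    LinearOrder.lift' (Fintype.equivFin σ) (Fintype.equivFin σ).injective
  exact ⟨MonomialOrder.lex⟩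

section
variable {K : Type*} [Field K] {n : ℕ} {F : Type*} [Field F]
  [Algebra (MvPolynomial (Fin n × Bool) K) F] [IsFractionRing (MvPolynomial (Fin n × Bool) K) F]
  {A : Type*} [Ring A] [Algebra F A] [Algebra K A] {j : K}
  {ψ : MvPolynomial (Fin n × Bool) K →ₐ[K] A} {M : (Fin n × Bool →₀ ℕ) → A}

lemma smulK (hψ : ∀ p, ψ p = algebraMap F A (algebraMap _ F p)) (c : K) (a : A) :
    c • a = algebraMap (MvPolynomial (Fin n × Bool) K) F (C c) • a := by
  rw [Algebra.smul_def, Algebra.smul_def, ← hψ, ← MvPolynomial.algebraMap_eq, ψ.commutes]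

lemma M_mem (hψ : ∀ p, ψ p = algebraMap F A (algebraMap _ F p)) (T : Tw j ψ M) (d) :
    M d ∈ Submodule.span F (Set.range fun r => M (toN r)) := by
  obtain ⟨e, he⟩ := exists_four d
  rw [he, T.four_add, hψ, ← Algebra.smul_def]
  exact Submodule.smul_mem _ _ (Submodule.subset_span ⟨hat d, rfl⟩)

lemma span_top (hψ : ∀ p, ψ p = algebraMap F A (algebraMap _ F p)) (T : Tw j ψ M) {G : Set A}
    (hG : ∀ s ∈ G, ∃ d, M d = s) (hgen : Algebra.adjoin F G = ⊤) :
    ⊤ ≤ Submodule.span F (Set.range fun r => M (toN r)) := by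
  set U := Submodule.span F (Set.range fun r => M (toN r)) with hU
  have hmul : ∀ a ∈ U, ∀ b ∈ U, a * b ∈ U := by
    have : U * U ≤ U := by
      conv_lhs => rw [hU]
      rw [Submodule.span_mul_span, Submodule.span_le]
      rintro _ ⟨_, ⟨r, rfl⟩, _, ⟨s, rfl⟩, rfl⟩
      simp only [T.mul]
      rw [smulK hψ]
      exact Submodule.smul_mem _ _ (M_mem hψ T _)
    exact fun a ha b hb => this (Submodule.mul_mem_mul ha hb)
  intro a _
  have ha : a ∈ Algebra.adjoin F G := by rw [hgen]; trivial
  induction ha using Algebra.adjoin_induction with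
  | mem s hs =>
    obtain ⟨d, rfl⟩ := hG s hs
    exact M_mem hψ T d
  | algebraMap r =>
    rw [Algebra.algebraMap_eq_smul_one, ← T.zero]
    exact Submodule.smul_mem _ _ (M_mem hψ T _)
  | add a b _ _ ha hb => exact add_mem (ha trivial) (hb trivial)
  | mul a b _ _ ha hb => exact hmul _ (ha trivial) _ (hb trivial)

lemma ind_of (hψ : ∀ p, ψ p = algebraMap F A (algebraMap _ F p))
    (hli : LinearIndependent F fun r => M (toN r)) : Ind ψ M := by
  intro p hp
  have := Fintype.linearIndependent_iff.1 hli (fun r => algebraMap _ F (p r)) (by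
    rw [← hp]
    exact Finset.sum_congr rfl fun r _ => by rw [hψ, Algebra.smul_def])
  funext r
  exact (IsFractionRing.injective (MvPolynomial (Fin n × Bool) K) F) (by simpa using this r)

lemma hat_of_mem {p : (Fin n × Bool → ZMod 4) → MvPolynomial (Fin n × Bool) K}
    {D : Fin n × Bool →₀ ℕ}
    (hD : D ∈ (∑ r, expand 4 (p r) * monomial (toN r) 1).support) :
    p (hat D) ≠ 0 := by
  classical
  obtain ⟨r, _, hr⟩ := Finset.mem_biUnion.1 (support_sum hD)
  have h1 := mem_support_iff.1 hr
  rw [coeff_mul_monomial'] at h1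
  split_ifs at h1 with h2
  · rw [mul_one] at h1
    have h3 := dvd_of_mem_expand (mem_support_iff.2 h1)
    have h4 : hat D = r := by
      rw [← hat_toN r]
      funext i
      unfold hat
      have h5 := h3 i
      have h6 := h2 i
      rw [Finsupp.tsub_apply] at h5
      rw [ZMod.natCast_eq_natCast_iff]
      exact ((Nat.modEq_iff_dvd' h6).2 h5).symm
    rw [h4]
    rintro h5
    rw [h5] at h1
    simp at h1
  · exact absurd rfl h1

theorem upper [CharZero K] (hψ : ∀ p, ψ p = algebraMap F A (algebraMap _ F p)) (T : Tw j ψ M)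
    (hli : LinearIndependent F fun r => M (toN r))
    (hsp : ⊤ ≤ Submodule.span F (Set.range fun r => M (toN r)))
    (V : Submodule F A) (hV : ∀ v ∈ V, v ^ 4 ∈ Set.range (algebraMap F A)) :
    Module.finrank F V ≤ 4 * n + 1 := by
  classical
  obtain ⟨m⟩ := nonempty_order (Fin n × Bool)
  let b := Module.Basis.mk hli hsp
  let S : Finset (Fin n × Bool → ZMod 4) := Finset.univ.filter fun r =>
    ∃ f : MvPolynomial (Fin n × Bool) K, f ≠ 0 ∧ Phi M f ∈ V.toAddSubgroup ∧ hat (m.degree f) = r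
  have I := ind_of hψ hli
  have hKS : KS S := by
    refine T.KS (m := m) I V.toAddSubgroup (algebraMap F A).range ?_ ?_ S ?_
    · rintro _ ⟨z, rfl⟩
      obtain ⟨p, q, hq, hz⟩ := IsFractionRing.div_surjective (A := MvPolynomial (Fin n × Bool) K) z
      refine ⟨p, q, nonZeroDivisors.ne_zero hq, ?_⟩
      rw [hψ, hψ, ← map_mul, ← hz, mul_div_cancel₀]
      exact IsFractionRing.to_map_ne_zero_of_mem_nonZeroDivisors hq
    · intro v hv
      exact hV v hv
    · intro r hr
      exact (Finset.mem_filter.1 hr).2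
  refine le_trans ?_ hKS.card_le
  let L : V →ₗ[F] (S → F) :=
    LinearMap.pi fun r => (b.coord r.1).comp V.subtype
  have hL : Function.Injective L := by
    rw [injective_iff_map_eq_zero]
    intro v hv
    by_contra hv0
    obtain ⟨q, hq⟩ := IsLocalization.exist_integer_multiples_of_finite
      (nonZeroDivisors (MvPolynomial (Fin n × Bool) K)) fun r => b.repr (v : A) r
    choose p hp using hq
    have hq0 : algebraMap (MvPolynomial (Fin n × Bool) K) F q ≠ 0 :=
      IsFractionRing.to_map_ne_zero_of_mem_nonZeroDivisors q.2
    have hp' : ∀ r, algebraMap _ F (p r) = algebraMap _ F (q : MvPolynomial (Fin n × Bool) K)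
        * b.repr (v : A) r := fun r => by rw [hp, Algebra.smul_def]
    set f := ∑ r, expand 4 (p r) * monomial (toN r) (1 : K) with hf
    have hfv : Phi M f = algebraMap _ F (q : MvPolynomial (Fin n × Bool) K) • (v : A) := by
      rw [hf, T.Phi_sum]
      conv_rhs => rw [← b.sum_repr (v : A), Finset.smul_sum]
      refine Finset.sum_congr rfl fun r _ => ?_
      rw [hψ, hp', smul_smul, ← Algebra.smul_def, Module.Basis.mk_apply]
    have hf0 : f ≠ 0 := by
      intro h
      rw [h, map_zero] at hfv
      rcases smul_eq_zero.1 hfv.symm with h | h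
      · exact hq0 h
      · exact hv0 (Subtype.ext h)
    have hr := hat_of_mem (m.degree_mem_support hf0)
    have hS : hat (m.degree f) ∈ S := by
      refine Finset.mem_filter.2 ⟨Finset.mem_univ _, f, hf0, ?_, rfl⟩
      rw [hfv]
      exact V.smul_mem _ v.2
    have h1 : b.repr (v : A) (hat (m.degree f)) = 0 := congrFun hv ⟨_, hS⟩
    have h2 := hp' (hat (m.degree f))
    rw [h1, mul_zero] at h2
    exact hr ((IsFractionRing.injective (MvPolynomial (Fin n × Bool) K) F) (by simpa using h2))
  simpa using LinearMap.finrank_le_finrank_of_injective hL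
end

section
variable {n : ℕ}

/-- base exponent -/
noncomputable def bs (n k : ℕ) : Fin n × Bool →₀ ℕ :=
  Finsupp.equivFunOnFinite.symm fun s =>
    if s.2 then (if s.1.val = k then 1 else 0) else (if s.1.val < k then 1 else 0)

/-- exponents of the maximal Kummer space -/
noncomputable def ex : Option (Fin n × Fin 4) → (Fin n × Bool →₀ ℕ)
  | none => bs n n
  | some (k, t) => Finsupp.single (k, false) (t : ℕ) + bs n k

lemma bs_true (k : ℕ) (l : Fin n) : bs n k (l, true) = if l.val = k then 1 else 0 := by
  simp [bs]

lemma bs_false (k : ℕ) (l : Fin n) : bs n k (l, false) = if l.val < k then 1 else 0 := by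
  simp [bs]

lemma tau_bs (k : Fin n) (e) : tau (bs n k) e = e (k, false) := by
  unfold tau
  rw [Finset.sum_eq_single k]
  · simp [bs_true]
  · intro l _ hl
    rw [bs_true, if_neg (fun h => hl (Fin.ext h)), zero_mul]
  · simp

lemma tau_bs_n (e) : tau (bs n n) e = 0 := by
  unfold tau
  refine Finset.sum_eq_zero fun l _ => ?_
  rw [bs_true, if_neg l.2.ne, zero_mul]

lemma tau_single (k : Fin n) (t : ℕ) (e) : tau (Finsupp.single (k, false) t) e = 0 := by
  unfold tau
  refine Finset.sum_eq_zero fun l _ => ?_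
  simp [Finsupp.single_apply]

lemma ex_lt (i : Option (Fin n × Fin 4)) (s) : ex i s < 4 := by
  rcases s with ⟨l, _ | _⟩ <;> rcases i with _ | ⟨k, t⟩
  · simp only [ex, bs_false]; split_ifs <;> omega
  · simp only [ex, Finsupp.add_apply, bs_false, Finsupp.single_apply, Prod.mk.injEq, and_true]
    have := t.2
    by_cases h : k = l
    · subst h; simp
    · simp only [h, if_false]; split_ifs <;> omega
  · simp only [ex, bs_true]; split_ifs <;> omega
  · simp only [ex, Finsupp.add_apply, bs_true, Finsupp.single_apply, Prod.mk.injEq]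
    split_ifs <;> simp_all

lemma toN_hat_ex (i : Option (Fin n × Fin 4)) : toN (hat (ex i)) = ex i := by
  ext s
  rw [toN_apply, hat, ZMod.val_natCast, Nat.mod_eq_of_lt (ex_lt i s)]

lemma ex_true (k : Fin n) (t) (l : Fin n) :
    ex (some (k, t)) (l, true) = if l.val = k then 1 else 0 := by
  simp [ex, bs_true, Finsupp.single_apply]

lemma ex_inj : Function.Injective (ex (n := n)) := by
  rintro (_ | ⟨k, t⟩) (_ | ⟨l, s⟩) h
  · rfl
  · have := DFunLike.congr_fun h (l, true)
    rw [ex_true, if_pos rfl, ex, bs_true, if_neg l.2.ne] at this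
    omega
  · have := DFunLike.congr_fun h (k, true)
    rw [ex_true, if_pos rfl, ex, bs_true, if_neg k.2.ne] at this
    omega
  · have := DFunLike.congr_fun h (k, true)
    rw [ex_true, ex_true, if_pos rfl] at this
    split_ifs at this with hkl
    obtain rfl := Fin.ext hkl
    have := DFunLike.congr_fun h (k, false)
    simp only [ex, Finsupp.add_apply, Finsupp.single_eq_same] at this
    have h2 : s = t := Fin.ext (by omega)
    rw [h2]

variable {K : Type*} [Field K] {F : Type*} [Field F]
  [Algebra (MvPolynomial (Fin n × Bool) K) F] [IsFractionRing (MvPolynomial (Fin n × Bool) K) F]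
  {A : Type*} [Ring A] [Algebra F A] [Algebra K A] {j : K}
  {ψ : MvPolynomial (Fin n × Bool) K →ₐ[K] A} {M : (Fin n × Bool →₀ ℕ) → A}

lemma M_pow_four (hψ : ∀ p, ψ p = algebraMap F A (algebraMap _ F p)) (T : Tw j ψ M) (d) :
    ∃ β : F, M d ^ 4 = algebraMap F A β := by
  have h2 : M d ^ 4 = (j ^ tau d d * j ^ tau d d * j ^ tau (d + d) (d + d)) • M (4 • d) := by
    rw [show 4 = 2 * 2 from rfl, pow_mul, pow_two, pow_two, T.mul, smul_mul_smul_comm, T.mul,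
      smul_smul]
    congr 2
    rw [mul_smul, two_smul, two_smul]
  rw [h2, T.four, smulK hψ, hψ, Algebra.smul_def, ← map_mul]
  exact ⟨_, rfl⟩

theorem lower (hψ : ∀ p, ψ p = algebraMap F A (algebraMap _ F p)) (T : Tw j ψ M)
    (hli : LinearIndependent F fun r => M (toN r)) :
    ∃ V : Submodule F A, (∀ v ∈ V, v ^ 4 ∈ Set.range (algebraMap F A)) ∧
      Module.finrank F V = 4 * n + 1 := by
  set J := algebraMap (MvPolynomial (Fin n × Bool) K) F (C j) with hJ
  have hJ2 : J ^ 2 = -1 := by rw [hJ, ← map_pow, ← map_pow, T.hj]; simp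
  refine ⟨Submodule.span F (Set.range fun i => M (ex i)), ?_, ?_⟩
  · intro v hv
    obtain ⟨c, rfl⟩ := (Submodule.mem_span_range_iff_exists_fun F).1 hv
    rw [Fintype.sum_option, Fintype.sum_prod_type]
    have key : ∀ d e, tau d e = 1 → tau e d = 0 → M d * M e = J • (M e * M d) := by
      intro d e h1 h2
      rw [T.mul, T.mul, h1, h2, pow_one, pow_zero, one_smul, add_comm e, smulK hψ]
    have tx : ∀ k t e, tau (ex (some (k, t)) : Fin n × Bool →₀ ℕ) e = e (k, false) := by
      intro k t e
      rw [ex, tau_add_left, tau_single, tau_bs, zero_add]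
    rw [qsum_pow hJ2]
    · refine (algebraMap F A).range.add_mem ?_ ((algebraMap F A).range.sum_mem ?_)
      · obtain ⟨β, hβ⟩ := M_pow_four hψ T (ex none)
        rw [smul_pow, hβ, Algebra.smul_def, ← map_mul]
        exact ⟨_, rfl⟩
      · intro k _
        obtain ⟨α, hα⟩ := M_pow_four hψ T (Finsupp.single (k, false) 1)
        obtain ⟨β, hβ⟩ := M_pow_four hψ T (bs n k)
        have hYX := key (bs n k) (Finsupp.single (k, false) 1) (by rw [tau_bs]; simp)
          (tau_single _ _ _)
        have := norm_pow hJ2 hα hβ hYX fun t => c (some (k, t))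
        have hp : ∀ t : ℕ, M (Finsupp.single (k, false) t) =
            M (Finsupp.single (k, false) 1) ^ t := by
          intro t
          induction t with
          | zero => simp [T.zero]
          | succ t ih =>
            rw [pow_succ, ← ih, T.mul, tau_single, pow_zero, one_smul, ← Finsupp.single_add]
        have hq : ∀ t : Fin 4, M (Finsupp.single (k, false) 1) ^ (t : ℕ) * M (bs n k) =
            M (ex (some (k, t))) := fun t => by
          rw [← hp, T.mul, tau_single, pow_zero, one_smul, ex]
        simp only [hq] at this
        exact this
    · intro k l hkl
      simp only [Finset.sum_mul, Finset.mul_sum, Finset.smul_sum]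
      rw [Finset.sum_comm]
      refine Finset.sum_congr rfl fun t _ => Finset.sum_congr rfl fun s _ => ?_
      rw [smul_mul_smul_comm, smul_mul_smul_comm, key, smul_comm, mul_comm]
      · rw [tx, ex, Finsupp.add_apply, bs_false, if_pos (show k.val < l.val from hkl)]
        simp [Finsupp.single_apply, hkl.ne']
      · rw [tx, ex, Finsupp.add_apply, bs_false, if_neg (show ¬ l.val < k.val from not_lt_of_gt hkl)]
        simp [Finsupp.single_apply, hkl.ne]
    · intro k
      simp only [Finset.sum_mul, Finset.mul_sum, Finset.smul_sum]
      refine Finset.sum_congr rfl fun t _ => ?_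
      rw [smul_mul_smul_comm, smul_mul_smul_comm, key, smul_comm, mul_comm]
      · rw [tx, ex, bs_false, if_pos k.2]
      · rw [ex, tau_bs_n]
  · rw [finrank_span_eq_card]
    · simp
      ring
    · have h := hli.comp (fun i => hat (ex i)) (fun a b hab => ex_inj (by
        have := congrArg toN hab
        simpa only [toN_hat_ex] using this))
      convert h using 1
      funext i
      simp only [Function.comp, toN_hat_ex]
end
end Kum



/-- Main theorem: let `F = K(α₁, β₁, …, αₙ, βₙ)` be the function field in `2n`
algebraically independent variables over a characteristic-zero field `K` containing a
primitive 4th root of unity `i` (realized as a fraction field `F` of the multivariate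
polynomial ring, with `αₖ` the image of the variable `(k, false)` and `βₖ` that of
`(k, true)`), and let `A` be the generic tensor product `⊗ₖ (αₖ, βₖ)_{4,F}` of `n`
cyclic algebras of degree 4 over `F`, i.e. a division `F`-algebra of dimension `16^n`
generated by `xₖ, yₖ` with `xₖ⁴ = αₖ·1`, `yₖ⁴ = βₖ·1`, `xₖ yₖ = i · yₖ xₖ`, and
generators of distinct indices commuting. Then every Kummer subspace `V` of `A`
(`v⁴ ∈ F·1` for all `v ∈ V`) has dimension at most `4n + 1`, and this bound is
attained. -/
theorem statement18 {K : Type*} [Field K] [CharZero K] (i : K) (hi : i ^ 2 = -1)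
    (n : ℕ) (hn : 1 ≤ n)
    {F : Type*} [Field F] [Algebra (MvPolynomial (Fin n × Bool) K) F]
    [IsFractionRing (MvPolynomial (Fin n × Bool) K) F]
    {A : Type*} [DivisionRing A] [Algebra F A]
    (hdim : Module.finrank F A = 16 ^ n)
    (x y : Fin n → A)
    (hx4 : ∀ k, x k ^ 4 =
      algebraMap F A (algebraMap (MvPolynomial (Fin n × Bool) K) F (MvPolynomial.X (k, false))))
    (hy4 : ∀ k, y k ^ 4 =
      algebraMap F A (algebraMap (MvPolynomial (Fin n × Bool) K) F (MvPolynomial.X (k, true))))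
    (hxy : ∀ k, x k * y k =
      (algebraMap (MvPolynomial (Fin n × Bool) K) F (MvPolynomial.C i)) • (y k * x k))
    (hxx : ∀ k l, k ≠ l → Commute (x k) (x l))
    (hyy : ∀ k l, k ≠ l → Commute (y k) (y l))
    (hxyc : ∀ k l, k ≠ l → Commute (x k) (y l))
    (hgen : Algebra.adjoin F (Set.range x ∪ Set.range y) = ⊤) :
    (∀ V : Submodule F A, (∀ v ∈ V, v ^ 4 ∈ Set.range (algebraMap F A)) →
      Module.finrank F V ≤ 4 * n + 1) ∧
    ∃ V : Submodule F A, (∀ v ∈ V, v ^ 4 ∈ Set.range (algebraMap F A)) ∧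
      Module.finrank F V = 4 * n + 1 := by
  classical
  letI : Algebra K A := Algebra.compHom A ((algebraMap (MvPolynomial (Fin n × Bool) K) F).comp
    (MvPolynomial.C : K →+* MvPolynomial (Fin n × Bool) K))
  let ψ : MvPolynomial (Fin n × Bool) K →ₐ[K] A :=
    { (algebraMap F A).comp (algebraMap (MvPolynomial (Fin n × Bool) K) F) with
      commutes' := fun _ => rfl }
  have hψ : ∀ p, ψ p = algebraMap F A (algebraMap _ F p) := fun _ => rfl
  have hj : (-i) ^ 2 = -1 := by rw [neg_sq, hi]
  have hyx : ∀ k, y k * x k = (-i) • (x k * y k) := by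
    intro k
    rw [hxy, ← Kum.smulK hψ, smul_smul, neg_mul, ← pow_two, hi, neg_neg, one_smul]
  have T := Kum.Mon_Tw hj hyx hxx hyy hxyc ψ hx4 hy4
  have hsp := Kum.span_top hψ T (G := Set.range x ∪ Set.range y) (by
    rintro _ (⟨k, rfl⟩ | ⟨k, rfl⟩)
    · exact ⟨_, by rw [Kum.Mon_x, pow_one]⟩
    · exact ⟨_, by rw [Kum.Mon_y, pow_one]⟩) hgen
  have hli := linearIndependent_of_top_le_span_of_card_eq_finrank hsp (by
    rw [hdim, Fintype.card_fun, ZMod.card, Fintype.card_prod, Fintype.card_fin, Fintype.card_bool,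
      mul_comm, pow_mul]
    norm_num)
  exact ⟨Kum.upper hψ T hli hsp, Kum.lower hψ T hli⟩
end
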